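/- arXiv:1201.1377 — 6 statements merged into one kernel-verified Lean document; each statement's English description precedes it below -/
import Mathlib

section
/- Let G = (V, W, E) be a bipartite graph with |V| = |W| = n and average degree d̄ = |E|/n. If G has no bipartite independent set of size k × k (where 1 ≤ k ≤ n and d̄ ≤ n − k), then n · [(n − d̄)(n − d̄ − 1)⋯(n − d̄ − k + 1)] / [n(n−1)⋯(n−k+1)] ≤ k − 1, i.e. n · C(n − d̄, k) ≤ (k − 1) · C(n, k), where C(x, k) = x(x−1)⋯(x−k+1)/k! denotes the generalized binomial coefficient for a real argument x. -/
/-- The generalized binomial coefficient `C(x, k) = x(x-1)⋯(x-k+1)/k!` for a real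
argument `x`. -/
noncomputable def genChoose (x : ℝ) (k : ℕ) : ℝ :=
  (∏ i ∈ Finset.range k, (x - i)) / (Nat.factorial k : ℝ)

/-- `E` has a bipartite independent set of size `k × k`: a pair of subsets
`S ⊆ V`, `T ⊆ W` of size `k` each with no edge between them. -/
def HasBipIndepSet (n k : ℕ) (E : Finset (Fin n × Fin n)) : Prop :=
  ∃ S T : Finset (Fin n), S.card = k ∧ T.card = k ∧ ∀ s ∈ S, ∀ t ∈ T, (s, t) ∉ E

theorem genChoose_eq_descPochhammer_eval (x : ℝ) (k : ℕ) :
    genChoose x k = (descPochhammer ℝ k).eval x / (k.factorial : ℝ) := by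
  rw [genChoose, descPochhammer_eval_eq_prod_range]

theorem genChoose_natCast (n k : ℕ) : genChoose (n : ℝ) k = (n.choose k : ℝ) := by
  rw [genChoose_eq_descPochhammer_eval, Nat.cast_choose_eq_descPochhammer_div]

/-- The vertices of `W` that are not adjacent to `v`. -/
def nonNeighbors {n : ℕ} (E : Finset (Fin n × Fin n)) (v : Fin n) : Finset (Fin n) :=
  {w | (v, w) ∉ E}

theorem sum_card_nonNeighbors {n : ℕ} (E : Finset (Fin n × Fin n)) :
    ∑ v, (nonNeighbors E v).card + E.card = n * n := by
  have h : Eᶜ.card = ∑ v, (nonNeighbors E v).card := by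
    rw [Finset.card_eq_sum_card_fiberwise (f := Prod.fst) (t := Finset.univ) (by simp)]
    refine Finset.sum_congr rfl fun v _ ↦ ?_
    refine (Finset.card_bij' (fun p _ ↦ p.2) (fun w _ ↦ (v, w)) ?_ ?_ ?_ ?_) <;>
      grind [nonNeighbors, Finset.mem_compl]
  rw [← h, Finset.card_compl_add_card]
  simp

/-- Double counting of the stars consisting of a vertex of `V` and `k` of its non-neighbors. -/
theorem sum_choose_card_nonNeighbors_le {n k : ℕ} {E : Finset (Fin n × Fin n)}
    (hno : ¬ HasBipIndepSet n k E) :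
    ∑ v, (nonNeighbors E v).card.choose k ≤ (k - 1) * n.choose k := by
  calc ∑ v, (nonNeighbors E v).card.choose k
      = ∑ v, (Finset.bipartiteAbove (fun v T ↦ T ⊆ nonNeighbors E v)
          (Finset.powersetCard k Finset.univ) v).card := by
        refine Finset.sum_congr rfl fun v _ ↦ ?_
        rw [← Finset.card_powersetCard]
        congr 1
        ext T
        simp [Finset.bipartiteAbove, Finset.mem_powersetCard, and_comm]
    _ = ∑ T ∈ Finset.powersetCard k Finset.univ,
          (Finset.bipartiteBelow (fun v T ↦ T ⊆ nonNeighbors E v) Finset.univ T).card :=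
        Finset.sum_card_bipartiteAbove_eq_sum_card_bipartiteBelow _
    _ ≤ (Finset.powersetCard k (Finset.univ : Finset (Fin n))).card • (k - 1) := by
        refine Finset.sum_le_card_nsmul _ _ _ fun T hT ↦ ?_
        by_contra! hlt
        obtain ⟨S, hS, hSk⟩ := Finset.exists_subset_card_eq (Nat.le_of_pred_lt (m := k) hlt)
        refine hno ⟨S, T, hSk, (Finset.mem_powersetCard.1 hT).2, fun s hs t ht ↦ ?_⟩
        have hsT := ((Finset.mem_bipartiteBelow _).1 (hS hs)).2 ht
        simpa [nonNeighbors] using hsT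
    _ = (k - 1) * n.choose k := by simp [mul_comm]

/-- Kővári–Sós–Turán (complementary form): if a bipartite graph `G = (V, W, E)` with
`|V| = |W| = n` and average degree `d̄ = |E|/n` has no bipartite independent set of
size `k × k` (where `1 ≤ k ≤ n` and `d̄ ≤ n - k`), then
`n · C(n - d̄, k) ≤ (k - 1) · C(n, k)`. -/
theorem stmt_0 (n k : ℕ) (E : Finset (Fin n × Fin n))
    (d : ℝ) (hd : d = (E.card : ℝ) / n)
    (hk1 : 1 ≤ k) (hkn : k ≤ n) (hdk : d ≤ (n : ℝ) - k)
    (hno : ¬ HasBipIndepSet n k E) :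
    (n : ℝ) * genChoose ((n : ℝ) - d) k ≤ ((k : ℝ) - 1) * genChoose (n : ℝ) k := by
  have hn : (0 : ℝ) < n := by exact_mod_cast hk1.trans hkn
  have hsum : (∑ v, ((nonNeighbors E v).card : ℝ)) + E.card = n * n := by
    exact_mod_cast sum_card_nonNeighbors E
  have havg : ∑ v, (n : ℝ)⁻¹ * ((nonNeighbors E v).card : ℝ) = n - d := by
    rw [← Finset.mul_sum, hd, eq_sub_of_add_eq hsum]
    field_simp
  have hjensen := descPochhammer_eval_div_factorial_le_sum_choose (n := k) (by omega)
    (t := Finset.univ) (fun v ↦ (nonNeighbors E v).card) (fun _ ↦ (n : ℝ)⁻¹)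
    (fun _ _ ↦ by positivity) (by simp [hn.ne']) (by rw [havg]; linarith)
  rw [havg, ← genChoose_eq_descPochhammer_eval, ← Finset.mul_sum, inv_mul_eq_div,
    le_div_iff₀' hn] at hjensen
  rw [genChoose_natCast, ← Nat.cast_pred hk1]
  exact hjensen.trans (by exact_mod_cast sum_choose_card_nonNeighbors_le hno)
end

section
/- Let G = (V, W, E) be a bipartite graph with |V| = |W| = n, average degree d̄ = |E|/n, and no bipartite independent set of size k × k, where 2 ≤ k ≤ n and d̄ ≤ n − k. Then d̄ ≥ (n − k + 1) · ln(n/(k−1)) / (k + ln(n/(k−1))). -/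
theorem mem_nonNeighbors {n : ℕ} {E : Finset (Fin n × Fin n)} {v w : Fin n} :
    w ∈ nonNeighbors E v ↔ (v, w) ∉ E := by
  simp [nonNeighbors]

theorem descPochhammer_eval_le_mul_exp {k : ℕ} {x y : ℝ} (hx : (k : ℝ) - 1 < x) (hxy : x ≤ y) :
    (descPochhammer ℝ k).eval y ≤
      (descPochhammer ℝ k).eval x * Real.exp (k * ((y - x) / (x - k + 1))) := by
  set c := (y - x) / (x - k + 1) with hc
  suffices h : ∀ j ≤ k, (descPochhammer ℝ j).eval y ≤
      (descPochhammer ℝ j).eval x * Real.exp (j * c) from h k le_rfl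
  intro j
  induction j with
  | zero => simp
  | succ j ih =>
    intro hj
    have hjk : (j : ℝ) + 1 ≤ k := by exact_mod_cast hj
    have hc0 : 0 ≤ c := div_nonneg (by linarith) (by linarith)
    have hfac : y - j ≤ (x - j) * Real.exp c := by
      have hcm : c * (x - k + 1) = y - x := by
        rw [hc]
        exact div_mul_cancel₀ _ (by linarith)
      have hexp := Real.add_one_le_exp c
      nlinarith [mul_nonneg hc0 (sub_nonneg.2 hjk)]
    have hpos : 0 < (descPochhammer ℝ j).eval x := descPochhammer_pos (by linarith)
    rw [descPochhammer_succ_eval, descPochhammer_succ_eval]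
    calc (descPochhammer ℝ j).eval y * (y - j)
        ≤ ((descPochhammer ℝ j).eval x * Real.exp (j * c)) * ((x - j) * Real.exp c) :=
          mul_le_mul (ih (by omega)) hfac (by linarith) (by positivity)
      _ = _ := by
          push_cast
          rw [add_mul, one_mul, Real.exp_add]
          ring

/-- If a bipartite graph `G = (V, W, E)` with `|V| = |W| = n` and average degree
`d̄ = |E|/n` has no bipartite independent set of size `k × k`, where `2 ≤ k ≤ n`
and `d̄ ≤ n - k`, then `d̄ ≥ (n - k + 1) · ln(n/(k-1)) / (k + ln(n/(k-1)))`. -/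
theorem stmt_1 (n k : ℕ) (E : Finset (Fin n × Fin n))
    (d : ℝ) (hd : d = (E.card : ℝ) / n)
    (hk1 : 2 ≤ k) (hkn : k ≤ n) (hdk : d ≤ (n : ℝ) - k)
    (hno : ¬ HasBipIndepSet n k E) :
    d ≥ ((n : ℝ) - k + 1) * Real.log ((n : ℝ) / ((k : ℝ) - 1)) /
        ((k : ℝ) + Real.log ((n : ℝ) / ((k : ℝ) - 1))) := by
  have hn : (0 : ℝ) < n := by exact_mod_cast (by omega : 0 < n)
  have hk : (2 : ℝ) ≤ k := by exact_mod_cast hk1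
  have hknR : (k : ℝ) ≤ n := by exact_mod_cast hkn
  have hd0 : 0 ≤ d := by rw [hd]; positivity
  have havg : ∑ v, (1 / n : ℝ) * ((nonNeighbors E v).card : ℝ) = n - d := by
    have h : (∑ v, ((nonNeighbors E v).card : ℝ)) + E.card = n * n := by
      exact_mod_cast sum_card_nonNeighbors E
    rw [← Finset.mul_sum, eq_sub_of_add_eq h, hd]
    field_simp
  have hjensen := descPochhammer_eval_div_factorial_le_sum_choose (n := k) (by omega)
    (t := Finset.univ) (fun v => (nonNeighbors E v).card) (fun _ => (1 / n : ℝ))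
    (fun _ _ => by positivity) (by simp [hn.ne']) (by rw [havg]; linarith)
  have hcount : ∑ v, ((nonNeighbors E v).card.choose k : ℝ) ≤ (k - 1) * n.choose k := by
    have h : ((∑ v, (nonNeighbors E v).card.choose k : ℕ) : ℝ) ≤ ((k - 1) * n.choose k : ℕ) :=
      Nat.cast_le.2 (sum_choose_card_nonNeighbors_le hno)
    rw [Nat.cast_mul, Nat.cast_sub (by omega)] at h
    simpa using h
  rw [havg, ← Finset.mul_sum] at hjensen
  have hP : 0 < (descPochhammer ℝ k).eval (n - d) := descPochhammer_pos (by linarith)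
  have hexp := descPochhammer_eval_le_mul_exp (k := k) (x := n - d) (y := n)
    (by linarith) (by linarith)
  rw [Nat.cast_choose_eq_descPochhammer_div] at hcount
  set A := (descPochhammer ℝ k).eval ((n : ℝ) - d)
  set B := (descPochhammer ℝ k).eval (n : ℝ)
  set X := Real.exp (k * ((n - (n - d)) / (n - d - k + 1)))
  have hfac : (0 : ℝ) < k.factorial := by positivity
  have hAB : n * A ≤ (k - 1) * B := by
    have h := hjensen.trans (mul_le_mul_of_nonneg_left hcount (by positivity))
    field_simp at h
    linarith
  have hnX : n / ((k : ℝ) - 1) ≤ X := by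
    rw [div_le_iff₀ (by linarith)]
    refine le_of_mul_le_mul_right ?_ hP
    nlinarith [mul_le_mul_of_nonneg_left hexp (by linarith : (0 : ℝ) ≤ k - 1)]
  have hlog : Real.log (n / ((k : ℝ) - 1)) ≤ k * ((n - (n - d)) / (n - d - k + 1)) :=
    (Real.log_le_iff_le_exp (div_pos hn (by linarith))).2 hnX
  have hlog0 : 0 ≤ Real.log (n / ((k : ℝ) - 1)) :=
    Real.log_nonneg ((one_le_div (by linarith)).2 (by linarith))
  rw [sub_sub_cancel, mul_div_assoc', le_div_iff₀ (by linarith)] at hlog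
  rw [ge_iff_le, div_le_iff₀ (by linarith)]
  linarith
end

section
/- There exists a constant c > 0 such that the following holds for all sufficiently large n: if n^{1/10} ≤ k ≤ n^{9/10} and G = (V, W, E) is a bipartite graph with |V| = |W| = n that has no bipartite independent set of size k × k, then |E| ≥ c · (n²/k) · log n. -/
open Finset in
/-- If every vertex of `T₀` has degree at most `D`, then for `j ≤ k ≤ n / 2` one can greedily choose
`j` left vertices whose common non-neighbourhood in `T₀` is large. -/
theorem exists_indep_of_degree_le {n k : ℕ} (E : Finset (Fin n × Fin n)) (T₀ : Finset (Fin n))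
    {D : ℝ} (hD : 0 ≤ D) (hn : 0 < n) (hkn : 2 * k ≤ n) (hx : 2 * D / n ≤ 1)
    (hdeg : ∀ t ∈ T₀, (#{s | (s, t) ∈ E} : ℝ) ≤ D) (j : ℕ) (hj : j ≤ k) :
    ∃ S T : Finset (Fin n), #S = j ∧ T ⊆ T₀ ∧ (1 - 2 * D / n) ^ j * #T₀ ≤ (#T : ℝ) ∧
      ∀ s ∈ S, ∀ t ∈ T, (s, t) ∉ E := by
  induction j with
  | zero => exact ⟨∅, T₀, by simp⟩
  | succ j ih =>
    obtain ⟨S, T, hS, hT, hcard, hind⟩ := ih (by lia)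
    have hn' : (0 : ℝ) < n := by exact_mod_cast hn
    have hkn' : (2 : ℝ) * k ≤ n := by exact_mod_cast hkn
    have hjk : (j : ℝ) ≤ k := by exact_mod_cast (by lia : j ≤ k)
    have hSc : ((#Sᶜ : ℕ) : ℝ) = n - j := by
      rw [card_compl, Fintype.card_fin, hS, Nat.cast_sub (by lia)]
    have hne : Sᶜ.Nonempty := by
      rw [← card_pos, card_compl, Fintype.card_fin, hS]
      lia
    have hsum : ∑ s ∈ Sᶜ, (#{t ∈ T | (s, t) ∈ E} : ℝ) ≤ ∑ s ∈ Sᶜ, 2 * D / n * #T := by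
      have hswap : ∑ s ∈ Sᶜ, #{t ∈ T | (s, t) ∈ E} = ∑ t ∈ T, #{s ∈ Sᶜ | (s, t) ∈ E} :=
        sum_card_bipartiteAbove_eq_sum_card_bipartiteBelow fun s t => (s, t) ∈ E
      calc ∑ s ∈ Sᶜ, (#{t ∈ T | (s, t) ∈ E} : ℝ)
          = ∑ t ∈ T, (#{s ∈ Sᶜ | (s, t) ∈ E} : ℝ) := by exact_mod_cast hswap
        _ ≤ ∑ t ∈ T, D := by
            refine sum_le_sum fun t ht => le_trans ?_ (hdeg t (hT ht))
            exact_mod_cast card_le_card (filter_subset_filter _ (subset_univ _))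
        _ = D * #T := by rw [sum_const, nsmul_eq_mul, mul_comm]
        _ = n / 2 * (2 * D / n * #T) := by field_simp
        _ ≤ (n - j) * (2 * D / n * #T) := by
            gcongr
            linarith
        _ = ∑ s ∈ Sᶜ, 2 * D / n * #T := by rw [sum_const, nsmul_eq_mul, hSc]
    obtain ⟨v, hv, hvle⟩ := exists_le_of_sum_le hne hsum
    rw [mem_compl] at hv
    refine ⟨insert v S, {t ∈ T | (v, t) ∉ E}, by rw [card_insert_of_notMem hv, hS],
      (filter_subset _ _).trans hT, ?_, ?_⟩
    · have hsplit : (#{t ∈ T | (v, t) ∈ E} : ℝ) + #{t ∈ T | (v, t) ∉ E} = #T := by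
        exact_mod_cast card_filter_add_card_filter_not (s := T) fun t => (v, t) ∈ E
      have := mul_le_mul_of_nonneg_left hcard (sub_nonneg.2 hx)
      rw [pow_succ]
      linarith
    · intro s hs t ht
      rw [mem_filter] at ht
      obtain rfl | hs := mem_insert.1 hs
      · exact ht.2
      · exact hind s hs t ht.1

open Finset in
/-- If `E` has at most `D * n / 2` edges, then at least half of the right vertices have degree at
most `D`. -/
theorem half_le_card_degree_le {n : ℕ} (E : Finset (Fin n × Fin n)) {D : ℝ} (hD : 0 < D)
    (hE : (#E : ℝ) ≤ D * n / 2) :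
    (n : ℝ) / 2 ≤ #{t : Fin n | (#{s | (s, t) ∈ E} : ℝ) ≤ D} := by
  have hfib : #E = ∑ t : Fin n, #{s | (s, t) ∈ E} := by
    rw [card_eq_sum_card_fiberwise (f := Prod.snd) (t := univ) (by simp)]
    refine sum_congr rfl fun t _ => ?_
    refine card_bij' (fun e _ => e.1) (fun s _ => (s, t)) ?_ ?_ ?_ ?_ <;> aesop
  have hsplit : (#{t : Fin n | (#{s | (s, t) ∈ E} : ℝ) ≤ D} : ℝ) +
      #{t : Fin n | ¬ (#{s | (s, t) ∈ E} : ℝ) ≤ D} = n := by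
    exact_mod_cast (card_filter_add_card_filter_not (s := univ)
      fun t : Fin n => (#{s | (s, t) ∈ E} : ℝ) ≤ D).trans (card_fin n)
  have hbig : (#{t : Fin n | ¬ (#{s | (s, t) ∈ E} : ℝ) ≤ D} : ℝ) * D ≤ #E := by
    rw [hfib, Nat.cast_sum, ← nsmul_eq_mul]
    refine (card_nsmul_le_sum _ (fun t => (#{s | (s, t) ∈ E} : ℝ)) _ ?_).trans
      (sum_le_sum_of_subset_of_nonneg (subset_univ _) fun _ _ _ => by positivity)
    intro t ht
    exact (not_le.1 (mem_filter.1 ht).2).le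
  have : (#{t : Fin n | ¬ (#{s | (s, t) ∈ E} : ℝ) ≤ D} : ℝ) ≤ n / 2 :=
    le_of_mul_le_mul_right (by linarith) hD
  linarith

theorem exp_neg_two_mul_le_one_sub {x : ℝ} (h₀ : 0 ≤ x) (h₁ : x ≤ 1 / 2) :
    Real.exp (-(2 * x)) ≤ 1 - x := by
  rw [Real.exp_neg, inv_le_iff_one_le_mul₀ (Real.exp_pos _)]
  nlinarith [Real.add_one_le_exp (2 * x)]


/-- There exists `c > 0` such that for all sufficiently large `n`: if
`n^(1/10) ≤ k ≤ n^(9/10)` and a bipartite graph `G = (V, W, E)` with `|V| = |W| = n`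
has no bipartite independent set of size `k × k`, then `|E| ≥ c · (n²/k) · log n`. -/
theorem stmt_2 :
    ∃ c : ℝ, c > 0 ∧ ∃ N : ℕ, ∀ n : ℕ, N ≤ n →
      ∀ k : ℕ, (n : ℝ) ^ ((1 : ℝ) / 10) ≤ (k : ℝ) → (k : ℝ) ≤ (n : ℝ) ^ ((9 : ℝ) / 10) →
      ∀ E : Finset (Fin n × Fin n), ¬ HasBipIndepSet n k E →
        (E.card : ℝ) ≥ c * ((n : ℝ) ^ 2 / (k : ℝ)) * Real.log n := by
  refine ⟨1 / 100, by norm_num, 2 ^ 50, fun n hN k hk₁ hk₂ E hE => ?_⟩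
  have hNn : (2 : ℝ) ^ 50 ≤ n := by exact_mod_cast hN
  have hn1 : (1 : ℝ) < n := lt_of_lt_of_le (by norm_num) hNn
  have hn0 : (0 : ℝ) < n := by linarith
  have hk0 : (0 : ℝ) < k := lt_of_lt_of_le (by positivity) hk₁
  have hlog : 0 < Real.log n := Real.log_pos hn1
  have hlogk : Real.log n ≤ 10 * k := by
    have := Real.log_le_rpow_div hn0.le (by norm_num : (0 : ℝ) < 1 / 10)
    linarith
  have htwo : (2 : ℝ) ≤ (n : ℝ) ^ ((1 : ℝ) / 50) := by
    calc (2 : ℝ) = ((2 : ℝ) ^ 50) ^ ((1 : ℝ) / 50) := by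
          rw [← Real.rpow_natCast, ← Real.rpow_mul (by norm_num)]
          norm_num
      _ ≤ _ := Real.rpow_le_rpow (by positivity) hNn (by norm_num)
  have hpow : 2 * (k : ℝ) ≤ (n : ℝ) ^ ((23 : ℝ) / 25) := by
    calc 2 * (k : ℝ) ≤ (n : ℝ) ^ ((1 : ℝ) / 50) * (n : ℝ) ^ ((9 : ℝ) / 10) := by gcongr
      _ = (n : ℝ) ^ ((23 : ℝ) / 25) := by
          rw [← Real.rpow_add hn0]
          norm_num
  have hkn : 2 * (k : ℝ) ≤ n :=
    hpow.trans (Real.rpow_le_self_of_one_le hn1.le (by norm_num))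
  by_contra! hlt
  refine hE ?_
  set D : ℝ := n / (50 * k) * Real.log n with hDdef
  have hD : 0 < D := by positivity
  have hx : 2 * D / n = Real.log n / (25 * k) := by
    rw [hDdef]
    field_simp
    norm_num
  have hx₀ : 0 ≤ 2 * D / n := by positivity
  have hx₁ : 2 * D / n ≤ 1 / 2 := by
    rw [hx, div_le_iff₀ (by positivity)]
    linarith
  have hhalf := half_le_card_degree_le E hD (by
    refine hlt.le.trans (le_of_eq ?_)
    rw [hDdef]
    field_simp
    norm_num)
  obtain ⟨S, T, hS, -, hT, hind⟩ := exists_indep_of_degree_le (k := k) E _ hD.le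
    (by exact_mod_cast hn0) (by exact_mod_cast hkn) (by linarith)
    (fun t ht => (Finset.mem_filter.1 ht).2) k le_rfl
  have hexp : (n : ℝ) ^ (-(2 : ℝ) / 25) ≤ (1 - 2 * D / n) ^ k := by
    calc (n : ℝ) ^ (-(2 : ℝ) / 25) = Real.exp (-(2 * (2 * D / n))) ^ k := by
          rw [Real.rpow_def_of_pos hn0, ← Real.exp_nat_mul, hx]
          congr 1
          field_simp
      _ ≤ _ := pow_le_pow_left₀ (Real.exp_pos _).le (exp_neg_two_mul_le_one_sub hx₀ hx₁) k
  have hkT : (k : ℝ) ≤ T.card := by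
    calc (k : ℝ) ≤ (n : ℝ) ^ ((23 : ℝ) / 25) / 2 := by linarith
      _ = (n : ℝ) ^ (-(2 : ℝ) / 25) * (n / 2) := by
          rw [mul_div_assoc', ← Real.rpow_add_one hn0.ne']
          norm_num
      _ ≤ _ := (mul_le_mul hexp hhalf (by positivity) (le_trans (by positivity) hexp)).trans hT
  obtain ⟨T', hT', hcard⟩ := Finset.exists_subset_card_eq (by exact_mod_cast hkT : k ≤ T.card)
  exact ⟨S, T', hS, hcard, fun s hs t ht => hind s hs t (hT' ht)⟩
end

section
/- There exists a constant A > 0 such that the following holds for all sufficiently large n: suppose n^{1/10} ≤ k ≤ n^{9/10}, and let α_1, …, α_r be reals with α_i ∈ [n^{-1/100}, n^{1/100}] for each i, such that n_i := α_i · (n/k) is a positive integer for each i. If ∑_{i : α_i ≤ 1} α_i² + ∑_{i : α_i > 1} α_i ≥ A · k · log n, then the sequence (n_1, n_2, …, n_r) is (n, k)-strong. -/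
/-- The sequence `(ns 0, …, ns (r-1))` is `(n, k)`-strong: there is a bipartite
graph `G = (V, W, E)` with `|V| = |W| = n` that is the union of complete bipartite
graphs `G_i = (V_i, W_i, V_i × W_i)` with `|V_i| = |W_i| = ns i`, and `G` has no
bipartite independent set of size `k × k`. -/
def IsStrong (n k r : ℕ) (ns : Fin r → ℕ) : Prop :=
  ∃ V W : Fin r → Finset (Fin n),
    (∀ i, (V i).card = ns i) ∧ (∀ i, (W i).card = ns i) ∧
    ¬ HasBipIndepSet n k
      ((Finset.univ : Finset (Fin n × Fin n)).filter
        (fun p => ∃ i, p.1 ∈ V i ∧ p.2 ∈ W i))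

/-- Union bound on a finite product space, in counting form. -/
lemma exists_pi_forall_exists_notMem {ι κ : Type*} [Fintype ι] [DecidableEq ι]
    {Ω : ι → Type*} [∀ i, Fintype (Ω i)] [∀ i, DecidableEq (Ω i)]
    (P : Finset κ) (bad : κ → ∀ i, Finset (Ω i))
    (h : ∑ p ∈ P, ∏ i, (bad p i).card < ∏ i, Fintype.card (Ω i)) :
    ∃ ω : ∀ i, Ω i, ∀ p ∈ P, ∃ i, ω i ∉ bad p i := by
  by_contra! hc
  have hsub : (Finset.univ : Finset (∀ i, Ω i)) ⊆
      P.biUnion fun p => Fintype.piFinset (bad p) := by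
    intro ω _
    obtain ⟨p, hp, hω⟩ := hc ω
    simp only [Finset.mem_biUnion, Fintype.mem_piFinset]
    exact ⟨p, hp, hω⟩
  have hcard := (Finset.card_le_card hsub).trans Finset.card_biUnion_le
  simp only [Fintype.card_piFinset, Finset.card_univ, Fintype.card_pi] at hcard
  omega

/-- The functions `Fin m → Fin n` whose range avoids `S`. -/
def avoiding {n : ℕ} (m : ℕ) (S : Finset (Fin n)) : Finset (Fin m → Fin n) :=
  Fintype.piFinset fun _ => Sᶜ

lemma mem_avoiding {n m : ℕ} {S : Finset (Fin n)} {f : Fin m → Fin n} :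
    f ∈ avoiding m S ↔ ∀ j, f j ∉ S := by
  simp [avoiding]

lemma card_avoiding_le {n m k : ℕ} {a : ℝ} {S : Finset (Fin n)} (hS : S.card = k) (hn : 0 < n)
    (hk : 0 < k) (ha : (m : ℝ) = a * ((n : ℝ) / k)) :
    ((avoiding m S).card : ℝ) ≤ (n : ℝ) ^ m * Real.exp (-a) := by
  have hkn : k ≤ n := by simpa [hS] using S.card_le_univ
  have hn' : (0 : ℝ) < n := by exact_mod_cast hn
  have hk' : (0 : ℝ) < k := by exact_mod_cast hk
  have hkn' : (k : ℝ) ≤ n := by exact_mod_cast hkn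
  have hcard : ((avoiding m S).card : ℝ) = (n - k : ℝ) ^ m := by
    simp [avoiding, Finset.card_compl, hS, Nat.cast_sub hkn]
  have hexp : Real.exp (-a) = Real.exp (-(k / n : ℝ)) ^ m := by
    rw [← Real.exp_nat_mul, ha]
    congr 1
    field_simp
  rw [hcard, hexp, ← mul_pow]
  refine pow_le_pow_left₀ (by linarith) ?_ m
  have h := Real.add_one_le_exp (-(k / n : ℝ))
  calc (n - k : ℝ) = n * (-(k / n : ℝ) + 1) := by field_simp; ring
    _ ≤ _ := by gcongr

/-- The pairs of functions whose ranges do not meet both `S` and `T`. -/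
def missing {n : ℕ} (m : ℕ) (S T : Finset (Fin n)) :
    Finset ((Fin m → Fin n) × (Fin m → Fin n)) :=
  ((avoiding m S)ᶜ ×ˢ (avoiding m T)ᶜ)ᶜ

lemma notMem_missing {n m : ℕ} {S T : Finset (Fin n)} {p : (Fin m → Fin n) × (Fin m → Fin n)} :
    p ∉ missing m S T ↔ (∃ j, p.1 j ∈ S) ∧ ∃ j, p.2 j ∈ T := by
  simp [missing, mem_avoiding]

lemma card_missing_le {n m k : ℕ} {a : ℝ} {S T : Finset (Fin n)} (hS : S.card = k)
    (hT : T.card = k) (hn : 0 < n) (hk : 0 < k) (ha : (m : ℝ) = a * ((n : ℝ) / k))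
    (ha0 : 0 ≤ a) :
    ((missing m S T).card : ℝ) ≤
      ((n : ℝ) ^ m * (n : ℝ) ^ m) * (1 - (1 - Real.exp (-a)) ^ 2) := by
  have h1 := card_avoiding_le hS hn hk ha
  have h2 := card_avoiding_le hT hn hk ha
  have he : Real.exp (-a) ≤ 1 := Real.exp_le_one_iff.2 (by linarith)
  have hpos : (0 : ℝ) ≤ (n : ℝ) ^ m := by positivity
  have hcompl (U : Finset (Fin n)) :
      (((avoiding m U)ᶜ).card : ℝ) = (n : ℝ) ^ m - (avoiding m U).card := by
    rw [Finset.card_compl, Nat.cast_sub (Finset.card_le_univ _)]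
    simp
  have hcard : ((missing m S T).card : ℝ) = (n : ℝ) ^ m * (n : ℝ) ^ m -
      ((n : ℝ) ^ m - (avoiding m S).card) * ((n : ℝ) ^ m - (avoiding m T).card) := by
    rw [missing, Finset.card_compl, Nat.cast_sub (Finset.card_le_univ _), Finset.card_product,
      Nat.cast_mul, hcompl, hcompl]
    simp
  have hmul : ((n : ℝ) ^ m * (1 - Real.exp (-a))) * ((n : ℝ) ^ m * (1 - Real.exp (-a))) ≤
      ((n : ℝ) ^ m - (avoiding m S).card) * ((n : ℝ) ^ m - (avoiding m T).card) := by
    have h0 : 0 ≤ (n : ℝ) ^ m * (1 - Real.exp (-a)) := mul_nonneg hpos (by linarith)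
    exact mul_le_mul (by linarith) (by linarith) h0 (by linarith)
  rw [hcard]
  linarith

lemma one_sub_sq_one_sub_exp_neg_le_of_le_one {a : ℝ} (ha0 : 0 ≤ a) (ha1 : a ≤ 1) :
    1 - (1 - Real.exp (-a)) ^ 2 ≤ Real.exp (-(a ^ 2 / 4)) := by
  have h1 : a / 2 ≤ 1 - Real.exp (-a) := by
    have h := Real.add_one_le_exp a
    have h' : Real.exp (-a) ≤ 1 / (a + 1) := by
      rw [Real.exp_neg, ← one_div]
      gcongr
    have h'' : 1 / (a + 1) ≤ 1 - a / 2 := by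
      rw [div_le_iff₀ (by linarith)]
      nlinarith
    linarith
  have h2 := Real.add_one_le_exp (-(a ^ 2 / 4))
  nlinarith

lemma one_sub_sq_one_sub_exp_neg_le_of_one_le {a : ℝ} (ha : 1 ≤ a) :
    1 - (1 - Real.exp (-a)) ^ 2 ≤ Real.exp (-(a / 4)) := by
  have h1 : 2 ≤ Real.exp (3 * a / 4) := by
    have h := Real.quadratic_le_exp_of_nonneg (x := 3 * a / 4) (by linarith)
    nlinarith
  have h2 : Real.exp (-(a / 4)) = Real.exp (3 * a / 4) * Real.exp (-a) := by
    rw [← Real.exp_add]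
    congr 1
    ring
  rw [h2]
  nlinarith [Real.exp_pos (-a)]

/-- If every pair of `k`-sets is hit, then enlarging the ranges gives a strong sequence. -/
lemma isStrong_of_forall_exists_notMem_missing {n k r : ℕ} {ns : Fin r → ℕ}
    (hns : ∀ i, ns i ≤ n) (ω : ∀ i, (Fin (ns i) → Fin n) × (Fin (ns i) → Fin n))
    (hω : ∀ S T : Finset (Fin n), S.card = k → T.card = k → ∃ i, ω i ∉ missing (ns i) S T) :
    IsStrong n k r ns := by
  have hext (i) (f : Fin (ns i) → Fin n) :
      ∃ U : Finset (Fin n), Finset.univ.image f ⊆ U ∧ U.card = ns i :=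
    Finset.exists_superset_card_eq (Finset.card_image_le.trans (by simp)) (by simpa using hns i)
  choose V hV hVc using fun i => hext i (ω i).1
  choose W hW hWc using fun i => hext i (ω i).2
  refine ⟨V, W, hVc, hWc, ?_⟩
  rintro ⟨S, T, hS, hT, hST⟩
  obtain ⟨i, hi⟩ := hω S T hS hT
  obtain ⟨⟨j, hj⟩, l, hl⟩ := notMem_missing.1 hi
  exact hST _ hj _ hl (Finset.mem_filter.2 ⟨Finset.mem_univ _, i,
    hV i (Finset.mem_image_of_mem _ (Finset.mem_univ _)),
    hW i (Finset.mem_image_of_mem _ (Finset.mem_univ _))⟩)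

/-- Symmetric sufficient condition with explicit constants and no restriction on the range of
`k`. -/
lemma isStrong_of_le_sum {n k r : ℕ} (hn : 2 ≤ n) (hk : 0 < k) {a : Fin r → ℝ} {ns : Fin r → ℕ}
    (ha0 : ∀ i, 0 ≤ a i) (hns : ∀ i, ns i ≤ n) (ha : ∀ i, (ns i : ℝ) = a i * ((n : ℝ) / k))
    (hsum : 12 * (k : ℝ) * Real.log n ≤
      (∑ i ∈ Finset.univ.filter (fun i => a i ≤ 1), a i ^ 2) +
        ∑ i ∈ Finset.univ.filter (fun i => 1 < a i), a i) :
    IsStrong n k r ns := by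
  have hn0 : (0 : ℝ) < n := by positivity
  let w : Fin r → ℝ := fun i => if a i ≤ 1 then a i ^ 2 else a i
  have hw : 12 * (k : ℝ) * Real.log n ≤ ∑ i, w i := by
    simpa only [w, Finset.sum_ite, not_le] using hsum
  let P : Finset (Finset (Fin n) × Finset (Fin n)) :=
    Finset.univ.powersetCard k ×ˢ Finset.univ.powersetCard k
  have hP : (P.card : ℝ) ≤ Real.exp (2 * k * Real.log n) := by
    have h : P.card ≤ n ^ (2 * k) := by
      simp only [P, Finset.card_product, Finset.card_powersetCard, Finset.card_univ,
        Fintype.card_fin, two_mul, pow_add]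
      exact Nat.mul_le_mul (Nat.choose_le_pow n k) (Nat.choose_le_pow n k)
    have h' : Real.exp (2 * k * Real.log n) = (n : ℝ) ^ (2 * k) := by
      rw [show (2 * k * Real.log n : ℝ) = (2 * k : ℕ) * Real.log n by push_cast; ring,
        Real.exp_nat_mul, Real.exp_log hn0]
    rw [h']
    exact_mod_cast h
  have hbad (p) (hp : p ∈ P) (i) : ((missing (ns i) p.1 p.2).card : ℝ) ≤
      ((n : ℝ) ^ ns i * (n : ℝ) ^ ns i) * Real.exp (-(w i / 4)) := by
    simp only [P, Finset.mem_product, Finset.mem_powersetCard_univ] at hp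
    refine (card_missing_le hp.1 hp.2 (by omega) hk (ha i) (ha0 i)).trans ?_
    gcongr
    dsimp only [w]
    split_ifs with h
    · exact one_sub_sq_one_sub_exp_neg_le_of_le_one (ha0 i) h
    · exact one_sub_sq_one_sub_exp_neg_le_of_one_le (not_le.1 h).le
  have hlt : ∑ p ∈ P, ∏ i, (missing (ns i) p.1 p.2).card <
      ∏ i, Fintype.card ((Fin (ns i) → Fin n) × (Fin (ns i) → Fin n)) := by
    rw [← Nat.cast_lt (α := ℝ)]
    have hcard : ((∏ i, Fintype.card ((Fin (ns i) → Fin n) × (Fin (ns i) → Fin n)) : ℕ) : ℝ) =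
        ∏ i, ((n : ℝ) ^ ns i * (n : ℝ) ^ ns i) := by simp
    rw [hcard]
    push_cast
    set M : ℝ := ∏ i, ((n : ℝ) ^ ns i * (n : ℝ) ^ ns i) with hM
    have hMpos : 0 < M := Finset.prod_pos fun i _ => by positivity
    have hlog : 0 < (k : ℝ) * Real.log n :=
      mul_pos (by exact_mod_cast hk) (Real.log_pos (by exact_mod_cast hn))
    calc ∑ p ∈ P, ∏ i, ((missing (ns i) p.1 p.2).card : ℝ)
        ≤ ∑ p ∈ P, M * Real.exp (-((∑ i, w i) / 4)) := by
          refine Finset.sum_le_sum fun p hp => ?_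
          rw [Finset.sum_div, ← Finset.sum_neg_distrib, Real.exp_sum, hM,
            ← Finset.prod_mul_distrib]
          exact Finset.prod_le_prod (fun i _ => by positivity) fun i _ => hbad p hp i
      _ = P.card * (M * Real.exp (-((∑ i, w i) / 4))) := by
          rw [Finset.sum_const, nsmul_eq_mul]
      _ ≤ Real.exp (2 * k * Real.log n) * (M * Real.exp (-((∑ i, w i) / 4))) := by gcongr
      _ = M * Real.exp (2 * k * Real.log n - (∑ i, w i) / 4) := by
          rw [sub_eq_add_neg, Real.exp_add]
          ring
      _ < M * 1 := by
          gcongr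
          rw [Real.exp_lt_one_iff]
          linarith
      _ = M := mul_one M
  obtain ⟨ω, hω⟩ := exists_pi_forall_exists_notMem P (fun p i => missing (ns i) p.1 p.2) hlt
  refine isStrong_of_forall_exists_notMem_missing hns ω fun S T hS hT => hω (S, T) ?_
  simp [P, hS, hT]


/-- Sufficient condition (symmetric case): there exists `A > 0` such that for all
sufficiently large `n`, if `n^(1/10) ≤ k ≤ n^(9/10)`, `α_i ∈ [n^(-1/100), n^(1/100)]`,
`n_i := α_i · (n/k)` is a positive integer for each `i`, and
`∑_{i : α_i ≤ 1} α_i² + ∑_{i : α_i > 1} α_i ≥ A · k · log n`, then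
`(n_1, …, n_r)` is `(n, k)`-strong. -/
theorem stmt_6 :
    ∃ A : ℝ, A > 0 ∧ ∃ N : ℕ, ∀ n : ℕ, N ≤ n →
      ∀ k : ℕ, (n : ℝ) ^ ((1 : ℝ) / 10) ≤ (k : ℝ) → (k : ℝ) ≤ (n : ℝ) ^ ((9 : ℝ) / 10) →
      ∀ r : ℕ, ∀ α : Fin r → ℝ, ∀ ns : Fin r → ℕ,
      (∀ i, (n : ℝ) ^ (-(1 : ℝ) / 100) ≤ α i ∧ α i ≤ (n : ℝ) ^ ((1 : ℝ) / 100)) →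
      (∀ i, 0 < ns i) →
      (∀ i, (ns i : ℝ) = α i * ((n : ℝ) / (k : ℝ))) →
      (∑ i ∈ Finset.univ.filter (fun i => α i ≤ 1), (α i) ^ 2) +
        (∑ i ∈ Finset.univ.filter (fun i => 1 < α i), α i) ≥
          A * (k : ℝ) * Real.log n →
      IsStrong n k r ns := by
  refine ⟨12, by norm_num, 2, fun n hn k hk _ r α ns hα _ hns hsum => ?_⟩
  have hn1 : (1 : ℝ) ≤ n := by exact_mod_cast (by omega : 1 ≤ n)
  have hk0 : (0 : ℝ) < k := (Real.rpow_pos_of_pos (by linarith) _).trans_le hk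
  have hα0 (i) : 0 ≤ α i := (Real.rpow_nonneg (by linarith) _).trans (hα i).1
  have hαk (i) : α i ≤ k := ((hα i).2.trans
    (Real.rpow_le_rpow_of_exponent_le hn1 (by norm_num))).trans hk
  refine isStrong_of_le_sum hn (by exact_mod_cast hk0) hα0 (fun i => ?_) hns hsum
  have h : (ns i : ℝ) ≤ n := by
    calc (ns i : ℝ) = α i * ((n : ℝ) / k) := hns i
      _ ≤ k * ((n : ℝ) / k) := by gcongr; exact hαk i
      _ = n := by field_simp
  exact_mod_cast h
end

section
/- There exists a constant B > 0 such that the following holds for all sufficiently large n: suppose n^{1/10} ≤ k ≤ n^{9/10}, and let α_1, …, α_r be reals with α_i ∈ [n^{-1/100}, n^{1/100}] for each i, such that n_i := α_i · (n/k) is a positive integer for each i. If the sequence (n_1, n_2, …, n_r) is (n, k)-strong, then ∑_{i : α_i ≤ 1} α_i² + ∑_{i : α_i > 1} α_i ≥ B · k · log n. -/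
lemma card_filter_superset {ι : Type*} [Fintype ι] [DecidableEq ι] (c : Finset ι) :
    (((Finset.univ : Finset (Finset ι)).filter (fun R => c ⊆ R)).card : ℝ) =
      2 ^ Fintype.card ι / 2 ^ c.card := by
  have h : (Finset.univ : Finset (Finset ι)).filter (fun R => c ⊆ R) =
      Finset.Icc c Finset.univ := by
    ext R; simp
  rw [h, Finset.card_Icc_finset (Finset.subset_univ c), Finset.card_univ, eq_div_iff (by positivity)]
  push_cast
  rw [← pow_add, Nat.sub_add_cancel (Finset.card_le_univ c)]

lemma card_filter_superset_disjoint_le {ι : Type*} [Fintype ι] [DecidableEq ι]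
    (c c' : Finset ι) :
    (((Finset.univ : Finset (Finset ι)).filter (fun R => c ⊆ R ∧ Disjoint R c')).card : ℝ) ≤
      2 ^ Fintype.card ι / 2 ^ (c.card + c'.card) := by
  have h : (Finset.univ : Finset (Finset ι)).filter (fun R => c ⊆ R ∧ Disjoint R c') =
      Finset.Icc c c'ᶜ := by
    ext R; simp [Finset.subset_compl_iff_disjoint_right]
  rw [h]
  by_cases hd : c ⊆ c'ᶜ
  · rw [Finset.card_Icc_finset hd, le_div_iff₀ (by positivity)]
    push_cast
    have h1 := Finset.card_le_card hd
    have h2 := Finset.card_compl_add_card c'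
    rw [← pow_add, ← h2]
    apply pow_le_pow_right₀ (by norm_num)
    omega
  · rw [Finset.Icc_eq_empty hd]
    simp only [Finset.card_empty, Nat.cast_zero]
    positivity

/-- Variance bound for the number of sets of a family of `D`-sets contained in a uniformly random
set `R`. -/
lemma sum_sq_card_superset_sub_le {ι α : Type*} [Fintype ι] [DecidableEq ι]
    (A : Finset α) (C : α → Finset ι) (D : ℕ) (L : ℝ) (hC : ∀ a ∈ A, (C a).card = D)
    (hL : ∀ a ∈ A, ((A.filter (fun a' => ¬ Disjoint (C a) (C a'))).card : ℝ) ≤ L) :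
    ∑ R : Finset ι, (((A.filter (fun a => C a ⊆ R)).card : ℝ) - A.card / 2 ^ D) ^ 2 ≤
      A.card * L * (2 ^ Fintype.card ι / 2 ^ D) := by
  set P : ℝ := 2 ^ Fintype.card ι with hP
  have hP0 : 0 < P := by positivity
  have hX : ∀ R : Finset ι, ((A.filter (fun a => C a ⊆ R)).card : ℝ) =
      ∑ a ∈ A, if C a ⊆ R then (1 : ℝ) else 0 := by
    intro R; simp
  have h1 : ∑ R : Finset ι, ((A.filter (fun a => C a ⊆ R)).card : ℝ) = A.card * (P / 2 ^ D) := by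
    simp_rw [hX]
    rw [Finset.sum_comm, ← nsmul_eq_mul, ← Finset.sum_const]
    refine Finset.sum_congr rfl fun a ha => ?_
    rw [← hC a ha, hP, ← card_filter_superset]
    simp
  have h2 : ∑ R : Finset ι, ((A.filter (fun a => C a ⊆ R)).card : ℝ) ^ 2 ≤
      A.card * (A.card * (P / 2 ^ (D + D)) + L * (P / 2 ^ D)) := by
    have : ∀ R : Finset ι, ((A.filter (fun a => C a ⊆ R)).card : ℝ) ^ 2 =
        ∑ a ∈ A, ∑ a' ∈ A, if C a ∪ C a' ⊆ R then (1 : ℝ) else 0 := by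
      intro R
      rw [hX, sq, Finset.sum_mul_sum]
      refine Finset.sum_congr rfl fun a _ => Finset.sum_congr rfl fun a' _ => ?_
      simp only [Finset.union_subset_iff]
      split_ifs <;> simp_all
    simp_rw [this]
    rw [Finset.sum_comm, ← nsmul_eq_mul (A.card), ← Finset.sum_const]
    refine Finset.sum_le_sum fun a ha => ?_
    rw [Finset.sum_comm]
    calc _ ≤ ∑ a' ∈ A, (P / 2 ^ (D + D) + if ¬ Disjoint (C a) (C a') then P / 2 ^ D else 0) := by
            refine Finset.sum_le_sum fun a' ha' => ?_
            have h3 : ∑ R : Finset ι, (if C a ∪ C a' ⊆ R then (1 : ℝ) else 0) =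
                P / 2 ^ (C a ∪ C a').card := by
              rw [hP, ← card_filter_superset]; simp
            rw [h3]
            by_cases hd : Disjoint (C a) (C a')
            · simp [Finset.card_union_of_disjoint hd, hC a ha, hC a' ha', hd]
            · rw [if_pos hd]
              have h4 : P / 2 ^ (C a ∪ C a').card ≤ P / 2 ^ D := by
                apply div_le_div_of_nonneg_left hP0.le (by positivity)
                apply pow_le_pow_right₀ (by norm_num)
                rw [← hC a ha]
                exact Finset.card_le_card Finset.subset_union_left
              have : 0 ≤ P / 2 ^ (D + D) := by positivity
              linarith
      _ ≤ _ := by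
            rw [Finset.sum_add_distrib, ← Finset.sum_filter, Finset.sum_const, Finset.sum_const,
              nsmul_eq_mul, nsmul_eq_mul]
            have : 0 ≤ P / 2 ^ D := by positivity
            gcongr
            exact hL a ha
  have h3 : ∑ R : Finset ι, (((A.filter (fun a => C a ⊆ R)).card : ℝ) - A.card / 2 ^ D) ^ 2 =
      ∑ R : Finset ι, ((A.filter (fun a => C a ⊆ R)).card : ℝ) ^ 2
      - 2 * (A.card / 2 ^ D) * ∑ R : Finset ι, ((A.filter (fun a => C a ⊆ R)).card : ℝ)
      + P * (A.card / 2 ^ D) ^ 2 := by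
    have hs : ∑ _R : Finset ι, ((A.card : ℝ) / 2 ^ D) ^ 2 = P * (A.card / 2 ^ D) ^ 2 := by
      rw [Finset.sum_const, nsmul_eq_mul, Finset.card_univ, Fintype.card_finset, hP]
      push_cast; rfl
    rw [← hs, Finset.mul_sum, ← Finset.sum_sub_distrib, ← Finset.sum_add_distrib]
    exact Finset.sum_congr rfl fun R _ => by ring
  rw [h3, h1]
  have h4 : (A.card : ℝ) * (A.card * (P / 2 ^ (D + D)) + L * (P / 2 ^ D))
      - 2 * (A.card / 2 ^ D) * (A.card * (P / 2 ^ D)) + P * (A.card / 2 ^ D) ^ 2 =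
      A.card * L * (P / 2 ^ D) := by
    rw [pow_add]; field_simp; ring
  linarith

/-- Two families of `D`-sets with few intersections inside each family: some `R` contains many
sets of the first family, is disjoint from many sets of the second, and the density of a given
bipartite graph does not grow much on the selected pairs. -/
lemma exists_random_restriction {ι α β : Type*} [Fintype ι] [DecidableEq ι]
    (A : Finset α) (B : Finset β) (C : α → Finset ι) (C' : β → Finset ι) (D : ℕ) (L δ : ℝ)
    (hC : ∀ a ∈ A, (C a).card = D) (hC' : ∀ b ∈ B, (C' b).card = D)
    (hL : ∀ a ∈ A, ((A.filter (fun a' => ¬ Disjoint (C a) (C a'))).card : ℝ) ≤ L)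
    (hL' : ∀ b ∈ B, ((B.filter (fun b' => ¬ Disjoint (C' b) (C' b'))).card : ℝ) ≤ L)
    (hA0 : 0 < A.card) (hB0 : 0 < B.card)
    (hA : 32 * L * 2 ^ D ≤ A.card) (hB : 32 * L * 2 ^ D ≤ B.card) (hδ : 0 < δ)
    (E : α → β → Prop) [∀ a b, Decidable (E a b)]
    (hE : (((A ×ˢ B).filter (fun p => E p.1 p.2)).card : ℝ) ≤ δ * A.card * B.card) :
    ∃ S ⊆ A, ∃ T ⊆ B, (A.card : ℝ) / 2 ^ D / 2 ≤ S.card ∧ (B.card : ℝ) / 2 ^ D / 2 ≤ T.card ∧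
      (((S ×ˢ T).filter (fun p => E p.1 p.2)).card : ℝ) ≤ 8 * δ * S.card * T.card ∧
      ∀ s ∈ S, ∀ t ∈ T, Disjoint (C s) (C' t) := by
  have hA0' : (0 : ℝ) < A.card := by exact_mod_cast hA0
  have hB0' : (0 : ℝ) < B.card := by exact_mod_cast hB0
  set P : ℝ := 2 ^ Fintype.card ι with hP
  have hP0 : 0 < P := by positivity
  let S : Finset ι → Finset α := fun R => A.filter (fun a => C a ⊆ R)
  let T : Finset ι → Finset β := fun R => B.filter (fun b => C' b ⊆ Rᶜ)
  let e : Finset ι → ℝ := fun R => ((S R ×ˢ T R).filter (fun p => E p.1 p.2)).card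
  set μ : ℝ := A.card / 2 ^ D with hμ
  set ν : ℝ := B.card / 2 ^ D with hν
  have hμ0 : 0 < μ := by positivity
  have hν0 : 0 < ν := by positivity
  have hS : ∑ R, ((S R).card - μ) ^ 2 ≤ A.card * L * (P / 2 ^ D) :=
    sum_sq_card_superset_sub_le A C D L hC hL
  have hT : ∑ R, ((T R).card - ν) ^ 2 ≤ B.card * L * (P / 2 ^ D) := by
    refine le_trans (le_of_eq ?_) (sum_sq_card_superset_sub_le B C' D L hC' hL')
    exact Function.Bijective.sum_comp (compl_bijective (α := Finset ι))
      (fun R => (((B.filter (fun b => C' b ⊆ R)).card : ℝ) - B.card / 2 ^ D) ^ 2)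
  have he : ∑ R, e R ≤ δ * μ * ν * P := by
    have h1 : ∀ R, e R = ∑ p ∈ (A ×ˢ B).filter (fun p => E p.1 p.2),
        if C p.1 ⊆ R ∧ Disjoint R (C' p.2) then (1 : ℝ) else 0 := by
      intro R
      rw [Finset.sum_boole, Finset.filter_filter]
      simp only [e, S, T]
      congr 2
      ext p
      simp only [Finset.mem_filter, Finset.mem_product, Finset.subset_compl_iff_disjoint_right,
        disjoint_comm]
      tauto
    simp_rw [h1]
    rw [Finset.sum_comm]
    calc _ ≤ ∑ p ∈ (A ×ˢ B).filter (fun p => E p.1 p.2), P / 2 ^ (D + D) := by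
            refine Finset.sum_le_sum fun p hp => ?_
            simp only [Finset.mem_filter, Finset.mem_product] at hp
            have := card_filter_superset_disjoint_le (C p.1) (C' p.2)
            rw [hC _ hp.1.1, hC' _ hp.1.2] at this
            rw [Finset.sum_boole]
            exact this
      _ ≤ (δ * A.card * B.card) * (P / 2 ^ (D + D)) := by
            rw [Finset.sum_const, nsmul_eq_mul]
            gcongr
      _ = δ * μ * ν * P := by rw [hμ, hν, pow_add]; field_simp
  obtain ⟨R, -, hR⟩ : ∃ R ∈ (Finset.univ : Finset (Finset ι)),
      4 / μ ^ 2 * ((S R).card - μ) ^ 2 + 4 / ν ^ 2 * ((T R).card - ν) ^ 2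
        + 1 / (2 * δ * μ * ν) * e R ≤ 1 := by
    apply Finset.exists_le_of_sum_le Finset.univ_nonempty
    rw [Finset.sum_add_distrib, Finset.sum_add_distrib, ← Finset.mul_sum, ← Finset.mul_sum,
      ← Finset.mul_sum]
    have h1 : 4 / μ ^ 2 * ∑ R, ((S R).card - μ) ^ 2 ≤ P / 8 := by
      calc _ ≤ 4 / μ ^ 2 * (A.card * L * (P / 2 ^ D)) := by gcongr
        _ = (32 * L * 2 ^ D) / A.card * (P / 8) := by rw [hμ]; field_simp; ring
        _ ≤ 1 * (P / 8) := by
            gcongr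
            exact (div_le_one hA0').2 hA
        _ = P / 8 := one_mul _
    have h2 : 4 / ν ^ 2 * ∑ R, ((T R).card - ν) ^ 2 ≤ P / 8 := by
      calc _ ≤ 4 / ν ^ 2 * (B.card * L * (P / 2 ^ D)) := by gcongr
        _ = (32 * L * 2 ^ D) / B.card * (P / 8) := by rw [hν]; field_simp; ring
        _ ≤ 1 * (P / 8) := by
            gcongr
            exact (div_le_one hB0').2 hB
        _ = P / 8 := one_mul _
    have h3 : 1 / (2 * δ * μ * ν) * ∑ R, e R ≤ P / 2 := by
      calc _ ≤ 1 / (2 * δ * μ * ν) * (δ * μ * ν * P) := by gcongr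
        _ = P / 2 := by field_simp
    have h4 : ∑ _R : Finset ι, (1 : ℝ) = P := by simp [hP]
    rw [h4]
    linarith
  have half : ∀ {x m : ℝ}, 0 < m → 4 / m ^ 2 * (x - m) ^ 2 ≤ 1 → m / 2 ≤ x := by
    intro x m hm h
    rw [div_mul_eq_mul_div, div_le_one (by positivity)] at h
    nlinarith
  have n1 : 0 ≤ 4 / μ ^ 2 * ((S R).card - μ) ^ 2 := by positivity
  have n2 : 0 ≤ 4 / ν ^ 2 * ((T R).card - ν) ^ 2 := by positivity
  have n3 : 0 ≤ 1 / (2 * δ * μ * ν) * e R := by positivity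
  have hSR : μ / 2 ≤ (S R).card := half hμ0 (by linarith)
  have hTR : ν / 2 ≤ (T R).card := half hν0 (by linarith)
  refine ⟨S R, Finset.filter_subset _ _, T R, Finset.filter_subset _ _, hSR, hTR, ?_, ?_⟩
  · have h1 : 1 / (2 * δ * μ * ν) * e R ≤ 1 := by linarith
    rw [div_mul_eq_mul_div, one_mul, div_le_one (by positivity)] at h1
    refine h1.trans ?_
    calc 2 * δ * μ * ν = 8 * δ * (μ / 2) * (ν / 2) := by ring
      _ ≤ _ := by gcongr
  · intro s hs t ht
    have h1 := (Finset.mem_filter.1 hs).2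
    have h2 := (Finset.mem_filter.1 ht).2
    exact Finset.disjoint_of_subset_left h1 (Finset.subset_compl_iff_disjoint_left.1 h2)

/-- Greedy selection of `k` vertices on the left of a sparse bipartite graph with many common
non-neighbours. -/
lemma exists_bipartite_independent {α β : Type*} [DecidableEq α] (S : Finset α) (T : Finset β)
    (E : α → β → Prop) [∀ a b, Decidable (E a b)] (δ : ℝ) (k : ℕ) (hS : 0 < S.card)
    (hk : 2 * k ≤ S.card) (hδ0 : 0 < δ) (hδ : 4 * δ ≤ 1)
    (hE : (((S ×ˢ T).filter (fun p => E p.1 p.2)).card : ℝ) ≤ δ * S.card * T.card) :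
    ∃ S' ⊆ S, ∃ T' ⊆ T, S'.card = k ∧ (1 - 4 * δ) ^ k * (T.card / 2) ≤ T'.card ∧
      ∀ s ∈ S', ∀ t ∈ T', ¬ E s t := by
  have hS' : (0 : ℝ) < S.card := by exact_mod_cast hS
  let deg : β → ℝ := fun t => (S.filter (fun s => E s t)).card
  let T₀ := T.filter (fun t => deg t ≤ 2 * δ * S.card)
  have hT₀ : (T.card : ℝ) / 2 ≤ T₀.card := by
    have h1 : (((S ×ˢ T).filter (fun p => E p.1 p.2)).card : ℝ) = ∑ t ∈ T, deg t := by
      simp only [deg]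
      rw [Finset.card_filter, Finset.sum_product_right]
      push_cast
      simp
    have h2 : ∑ t ∈ T.filter (fun t => ¬ deg t ≤ 2 * δ * S.card), (2 * δ * S.card) ≤
        ∑ t ∈ T, deg t := by
      calc _ ≤ ∑ t ∈ T.filter (fun t => ¬ deg t ≤ 2 * δ * S.card), deg t :=
            Finset.sum_le_sum fun t ht => (not_le.1 (Finset.mem_filter.1 ht).2).le
        _ ≤ _ := Finset.sum_le_sum_of_subset_of_nonneg (Finset.filter_subset _ _)
            fun t _ _ => Nat.cast_nonneg _
    rw [Finset.sum_const, nsmul_eq_mul, ← h1] at h2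
    have h3 : ((T₀.card : ℝ) + (T.filter (fun t => ¬ deg t ≤ 2 * δ * S.card)).card) = T.card := by
      exact_mod_cast Finset.card_filter_add_card_filter_not (s := T)
        (fun t => deg t ≤ 2 * δ * S.card)
    have h4 := h2.trans hE
    have h5 : ((T.filter (fun t => ¬ deg t ≤ 2 * δ * S.card)).card : ℝ) * 2 ≤ T.card := by
      have : 0 < δ * S.card := by positivity
      nlinarith
    linarith
  have key : ∀ j ≤ k, ∃ S' ⊆ S, ∃ T' ⊆ T₀, S'.card = j ∧
      (1 - 4 * δ) ^ j * (T.card / 2) ≤ T'.card ∧ ∀ s ∈ S', ∀ t ∈ T', ¬ E s t := by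
    intro j
    induction j with
    | zero => exact fun _ => ⟨∅, by simp, T₀, subset_rfl, by simp, by simpa using hT₀, by simp⟩
    | succ j ih =>
      intro hj
      obtain ⟨S', hS'S, T', hT'T, hcard, hlow, hind⟩ := ih (by omega)
      have hrem : ((S \ S').card : ℝ) + j = S.card := by
        rw [← hcard]
        exact_mod_cast Finset.card_sdiff_add_card_eq_card hS'S
      have hjS : (2 * (j : ℝ)) + 2 ≤ S.card := by
        have : 2 * j + 2 ≤ S.card := by omega
        exact_mod_cast this
      have hne : (S \ S').Nonempty := by
        rw [← Finset.card_pos]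
        have : (0 : ℝ) < (S \ S').card := by linarith [(Nat.cast_nonneg j : (0 : ℝ) ≤ j)]
        exact_mod_cast this
      obtain ⟨s, hs, hsdeg⟩ : ∃ s ∈ S \ S',
          ((T'.filter (fun t => E s t)).card : ℝ) ≤ 4 * δ * T'.card := by
        apply Finset.exists_le_of_sum_le hne
        rw [Finset.sum_const, nsmul_eq_mul]
        calc ∑ s ∈ S \ S', ((T'.filter (fun t => E s t)).card : ℝ)
            ≤ ∑ s ∈ S, ((T'.filter (fun t => E s t)).card : ℝ) :=
              Finset.sum_le_sum_of_subset_of_nonneg Finset.sdiff_subset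
                fun _ _ _ => Nat.cast_nonneg _
          _ = ∑ t ∈ T', deg t := by
              simp only [deg]
              exact_mod_cast Finset.sum_card_bipartiteAbove_eq_sum_card_bipartiteBelow E
          _ ≤ ∑ t ∈ T', 2 * δ * S.card :=
              Finset.sum_le_sum fun t ht => (Finset.mem_filter.1 (hT'T ht)).2
          _ = T'.card * (2 * δ * S.card) := by rw [Finset.sum_const, nsmul_eq_mul]
          _ ≤ (S \ S').card * (4 * δ * T'.card) := by
              have : 0 ≤ δ * T'.card := by positivity
              nlinarith
      obtain ⟨hsS, hsS'⟩ := Finset.mem_sdiff.1 hs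
      refine ⟨insert s S', Finset.insert_subset hsS hS'S, T'.filter (fun t => ¬ E s t),
        (Finset.filter_subset _ _).trans hT'T, by rw [Finset.card_insert_of_notMem hsS', hcard],
        ?_, ?_⟩
      · have h1 : ((T'.filter (fun t => E s t)).card : ℝ) +
            (T'.filter (fun t => ¬ E s t)).card = T'.card := by
          exact_mod_cast Finset.card_filter_add_card_filter_not (s := T') (fun t => E s t)
        have h2 : (1 - 4 * δ) * ((1 - 4 * δ) ^ j * (T.card / 2)) ≤ (1 - 4 * δ) * T'.card :=
          mul_le_mul_of_nonneg_left hlow (by linarith)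
        calc _ = (1 - 4 * δ) * ((1 - 4 * δ) ^ j * (T.card / 2)) := by ring
          _ ≤ _ := h2
          _ ≤ _ := by linarith
      · intro s' hs' t ht
        obtain ⟨ht1, ht2⟩ := Finset.mem_filter.1 ht
        rcases Finset.mem_insert.1 hs' with rfl | h
        · exact ht2
        · exact hind _ h _ ht1
  obtain ⟨S', h1, T', h2, h3⟩ := key k le_rfl
  exact ⟨S', h1, T', h2.trans (Finset.filter_subset _ _), h3⟩

/-- Among the vertices lying in at most `D` of the sets `V i`, `i ∈ I`, the incidence sets can be
padded by private elements to have exactly `D` elements. -/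
lemma exists_padded_incidence {n r : ℕ} (V : Fin r → Finset (Fin n)) (I : Finset (Fin r)) (D : ℕ)
    (M : ℝ) (hM0 : 0 ≤ M) (hM : ∀ i ∈ I, ((V i).card : ℝ) ≤ M) (hn : 0 < n)
    (hsum : ∑ i ∈ I, ((V i).card : ℝ) ≤ D * n / 2) :
    ∃ (A : Finset (Fin n)) (C : Fin n → Finset (Fin r ⊕ Fin n × Fin D)),
      (n : ℝ) / 2 ≤ A.card ∧ (∀ a ∈ A, (C a).card = D) ∧
      (∀ a, ∀ i ∈ I, a ∈ V i → Sum.inl i ∈ C a) ∧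
      ∀ a ∈ A, ((A.filter (fun a' => ¬ Disjoint (C a) (C a'))).card : ℝ) ≤ 1 + D * M := by
  let d : Fin n → Finset (Fin r) := fun a => I.filter (fun i => a ∈ V i)
  have hJ : ∀ a, ∃ J : Finset (Fin D), J.card = D - (d a).card := by
    intro a
    obtain ⟨J, -, hJ⟩ := Finset.exists_subset_card_eq
      (show D - (d a).card ≤ (Finset.univ : Finset (Fin D)).card by simp)
    exact ⟨J, hJ⟩
  choose J hJ using hJ
  refine ⟨Finset.univ.filter (fun a => (d a).card ≤ D), fun a => (d a).disjSum ({a} ×ˢ J a),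
    ?_, ?_, ?_, ?_⟩
  · have h1 : ∑ i ∈ I, ((V i).card : ℝ) = ∑ a : Fin n, ((d a).card : ℝ) := by
      simp only [d]
      rw [← Nat.cast_sum, ← Nat.cast_sum]
      congr 1
      have := Finset.sum_card_bipartiteAbove_eq_sum_card_bipartiteBelow
        (s := (Finset.univ : Finset (Fin n))) (t := I) (fun a i => a ∈ V i)
      simpa [Finset.bipartiteBelow, Finset.bipartiteAbove] using this.symm
    have h2 : ∑ a ∈ Finset.univ.filter (fun a => ¬ (d a).card ≤ D), ((D : ℝ) + 1) ≤
        ∑ a : Fin n, ((d a).card : ℝ) := by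
      calc _ ≤ ∑ a ∈ Finset.univ.filter (fun a => ¬ (d a).card ≤ D), ((d a).card : ℝ) := by
            refine Finset.sum_le_sum fun a ha => ?_
            have := (Finset.mem_filter.1 ha).2
            exact_mod_cast (not_le.1 this)
        _ ≤ _ := Finset.sum_le_sum_of_subset_of_nonneg (Finset.filter_subset _ _)
            fun _ _ _ => Nat.cast_nonneg _
    rw [Finset.sum_const, nsmul_eq_mul, ← h1] at h2
    have h3 : (((Finset.univ.filter (fun a => (d a).card ≤ D)).card : ℝ) +
        (Finset.univ.filter (fun a => ¬ (d a).card ≤ D)).card) = n := by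
      have := Finset.card_filter_add_card_filter_not (s := (Finset.univ : Finset (Fin n)))
        (fun a => (d a).card ≤ D)
      rw [Finset.card_univ, Fintype.card_fin] at this
      exact_mod_cast this
    have h4 := h2.trans hsum
    have hn' : (0 : ℝ) < n := by exact_mod_cast hn
    have hD : (0 : ℝ) ≤ D := Nat.cast_nonneg _
    by_contra hcon
    have h5 : (n : ℝ) / 2 < (Finset.univ.filter (fun a => ¬ (d a).card ≤ D)).card := by linarith
    nlinarith
  · intro a ha
    have := (Finset.mem_filter.1 ha).2
    simp only [Finset.card_disjSum, Finset.card_product, Finset.card_singleton, hJ]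
    omega
  · intro a i hi ha
    simp [d, hi, ha]
  · intro a ha
    have hda := (Finset.mem_filter.1 ha).2
    have hsub : (Finset.univ.filter (fun a => (d a).card ≤ D)).filter
        (fun a' => ¬ Disjoint ((d a).disjSum ({a} ×ˢ J a)) ((d a').disjSum ({a'} ×ˢ J a'))) ⊆
        insert a ((d a).biUnion V) := by
      intro a' ha'
      obtain ⟨x, hx, hx'⟩ := Finset.not_disjoint_iff.1 (Finset.mem_filter.1 ha').2
      rcases x with i | ⟨b, j⟩
      · simp only [Finset.inl_mem_disjSum] at hx hx'
        exact Finset.mem_insert_of_mem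
          (Finset.mem_biUnion.2 ⟨i, hx, (Finset.mem_filter.1 hx').2⟩)
      · simp only [Finset.inr_mem_disjSum, Finset.mem_product, Finset.mem_singleton] at hx hx'
        rw [← hx'.1, hx.1]
        exact Finset.mem_insert_self _ _
    have h1 : (((d a).biUnion V).card : ℝ) ≤ ∑ i ∈ d a, ((V i).card : ℝ) := by
      exact_mod_cast Finset.card_biUnion_le
    have h2 : ∑ i ∈ d a, ((V i).card : ℝ) ≤ D * M := by
      calc _ ≤ ∑ i ∈ d a, M :=
            Finset.sum_le_sum fun i hi => hM i (Finset.mem_filter.1 hi).1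
        _ = (d a).card * M := by rw [Finset.sum_const, nsmul_eq_mul]
        _ ≤ D * M := by gcongr
    have h3 : ((insert a ((d a).biUnion V)).card : ℝ) ≤ ((d a).biUnion V).card + 1 := by
      exact_mod_cast Finset.card_insert_le _ _
    have h4 := (Nat.cast_le (α := ℝ)).2 (Finset.card_le_card hsub)
    linarith

/-- If the bicliques indexed by `I` have small total size and the remaining ones have few edges in
total, then their union has a `k × k` bipartite independent set. -/
lemma hasBipIndepSet_of_few_bicliques {n k r : ℕ} (V W : Fin r → Finset (Fin n))
    (I : Finset (Fin r)) (D : ℕ) (M δ : ℝ) (hn : 0 < n) (hM0 : 0 ≤ M) (hδ : 0 < δ)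
    (hVM : ∀ i ∈ I, ((V i).card : ℝ) ≤ M) (hWM : ∀ i ∈ I, ((W i).card : ℝ) ≤ M)
    (hVsum : ∑ i ∈ I, ((V i).card : ℝ) ≤ D * n / 2)
    (hWsum : ∑ i ∈ I, ((W i).card : ℝ) ≤ D * n / 2)
    (hsmall : ∑ i ∈ Iᶜ, ((V i).card : ℝ) * (W i).card ≤ δ * (n / 2) ^ 2)
    (hL : 32 * (1 + D * M) * 2 ^ D ≤ (n : ℝ) / 2) (hδ1 : 32 * δ ≤ 1)
    (hk : 2 * (k : ℝ) ≤ n / 2 / 2 ^ D / 2)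
    (hk' : (k : ℝ) ≤ (1 - 32 * δ) ^ k * (n / 2 / 2 ^ D / 2 / 2)) :
    HasBipIndepSet n k
      ((Finset.univ : Finset (Fin n × Fin n)).filter
        (fun p => ∃ i, p.1 ∈ V i ∧ p.2 ∈ W i)) := by
  classical
  have hn' : (0 : ℝ) < n := by exact_mod_cast hn
  obtain ⟨A, C, hA, hC, hCI, hCL⟩ := exists_padded_incidence V I D M hM0 hVM hn hVsum
  obtain ⟨B, C', hB, hC', hCI', hCL'⟩ := exists_padded_incidence W I D M hM0 hWM hn hWsum
  have hA0 : (0 : ℝ) < A.card := by linarith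
  have hB0 : (0 : ℝ) < B.card := by linarith
  let E : Fin n → Fin n → Prop := fun v w => ∃ i ∈ Iᶜ, v ∈ V i ∧ w ∈ W i
  have hE : (((A ×ˢ B).filter (fun p => E p.1 p.2)).card : ℝ) ≤ δ * A.card * B.card := by
    have hsub : (A ×ˢ B).filter (fun p => E p.1 p.2) ⊆ Iᶜ.biUnion (fun i => V i ×ˢ W i) := by
      intro p hp
      obtain ⟨i, hi, h⟩ := (Finset.mem_filter.1 hp).2
      exact Finset.mem_biUnion.2 ⟨i, hi, Finset.mem_product.2 h⟩
    calc (((A ×ˢ B).filter (fun p => E p.1 p.2)).card : ℝ)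
        ≤ (Iᶜ.biUnion (fun i => V i ×ˢ W i)).card := by
          exact_mod_cast Finset.card_le_card hsub
      _ ≤ ∑ i ∈ Iᶜ, ((V i).card : ℝ) * (W i).card := by
          have := Finset.card_biUnion_le (s := Iᶜ) (t := fun i => V i ×ˢ W i)
          simp only [Finset.card_product] at this
          exact_mod_cast this
      _ ≤ δ * (n / 2) ^ 2 := hsmall
      _ = δ * (n / 2) * (n / 2) := by ring
      _ ≤ _ := by gcongr
  obtain ⟨S, -, T, -, hS, hT, hST, hdisj⟩ := exists_random_restriction A B C C' D (1 + D * M) δ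
    hC hC' hCL hCL' (by exact_mod_cast hA0) (by exact_mod_cast hB0) (hL.trans hA) (hL.trans hB)
    hδ E hE
  have hS' : (n : ℝ) / 2 / 2 ^ D / 2 ≤ S.card := le_trans (by gcongr) hS
  have hT' : (n : ℝ) / 2 / 2 ^ D / 2 ≤ T.card := le_trans (by gcongr) hT
  have hS0 : (0 : ℝ) < S.card := lt_of_lt_of_le (by positivity) hS'
  obtain ⟨S', hS'S, T', hT'T, hS'k, hT'k, hind⟩ := exists_bipartite_independent S T E (8 * δ) k
    (by exact_mod_cast hS0) (by exact_mod_cast hk.trans hS') (by positivity) (by linarith) hST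
  have hkT : k ≤ T'.card := by
    have h0 : (0 : ℝ) ≤ (1 - 32 * δ) ^ k := pow_nonneg (by linarith) _
    have h1 : (1 - 32 * δ) ^ k * (n / 2 / 2 ^ D / 2 / 2) ≤
        (1 - 4 * (8 * δ)) ^ k * ((T.card : ℝ) / 2) := by
      rw [show 4 * (8 * δ) = 32 * δ by ring]
      gcongr
    exact_mod_cast hk'.trans (h1.trans hT'k)
  obtain ⟨T'', hT'', hT''k⟩ := Finset.exists_subset_card_eq hkT
  refine ⟨S', T'', hS'k, hT''k, fun s hs t ht hmem => ?_⟩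
  obtain ⟨i, hi⟩ := (Finset.mem_filter.1 hmem).2
  by_cases hI : i ∈ I
  · exact Finset.disjoint_left.1 (hdisj s (hS'S hs) t (hT'T (hT'' ht)))
      (hCI s i hI hi.1) (hCI' t i hI hi.2)
  · exact hind s hs t (hT'' ht) ⟨i, Finset.mem_compl.2 hI, hi⟩

lemma exp_neg_two_mul_le_one_sub_s7 {y : ℝ} (h0 : 0 ≤ y) (h1 : y ≤ 1 / 2) :
    Real.exp (-(2 * y)) ≤ 1 - y := by
  rw [Real.exp_neg]
  have h2 := Real.add_one_le_exp (2 * y)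
  rw [inv_le_iff_one_le_mul₀ (Real.exp_pos _)]
  nlinarith

/-- Necessary condition (symmetric case): there exists `B > 0` such that for all
sufficiently large `n`, if `n^(1/10) ≤ k ≤ n^(9/10)`, `α_i ∈ [n^(-1/100), n^(1/100)]`,
`n_i := α_i · (n/k)` is a positive integer for each `i`, and `(n_1, …, n_r)` is
`(n, k)`-strong, then `∑_{i : α_i ≤ 1} α_i² + ∑_{i : α_i > 1} α_i ≥ B · k · log n`. -/
theorem stmt_7 :
    ∃ B : ℝ, B > 0 ∧ ∃ N : ℕ, ∀ n : ℕ, N ≤ n →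
      ∀ k : ℕ, (n : ℝ) ^ ((1 : ℝ) / 10) ≤ (k : ℝ) → (k : ℝ) ≤ (n : ℝ) ^ ((9 : ℝ) / 10) →
      ∀ r : ℕ, ∀ α : Fin r → ℝ, ∀ ns : Fin r → ℕ,
      (∀ i, (n : ℝ) ^ (-(1 : ℝ) / 100) ≤ α i ∧ α i ≤ (n : ℝ) ^ ((1 : ℝ) / 100)) →
      (∀ i, 0 < ns i) →
      (∀ i, (ns i : ℝ) = α i * ((n : ℝ) / (k : ℝ))) →
      IsStrong n k r ns →
      (∑ i ∈ Finset.univ.filter (fun i => α i ≤ 1), (α i) ^ 2) +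
        (∑ i ∈ Finset.univ.filter (fun i => 1 < α i), α i) ≥
          B * (k : ℝ) * Real.log n := by
  refine ⟨1 / 10000, by norm_num, ⌈Real.exp 100000⌉₊, ?_⟩
  intro n hnN k hk1 hk2 r α ns hα hns0 hns hstrong
  have hnexp : Real.exp 100000 ≤ n := Nat.ceil_le.1 hnN
  have hn0 : (0 : ℝ) < n := (Real.exp_pos _).trans_le hnexp
  set x := Real.log n with hx
  have hx1 : 100000 ≤ x := (Real.le_log_iff_exp_le hn0).2 hnexp
  have hexp : Real.exp x = n := Real.exp_log hn0
  have hbig : x / 100 ≤ Real.exp (x / 100) := by linarith [Real.add_one_le_exp (x / 100)]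
  have hxexp : x ≤ Real.exp (x / 100) := by
    have h1 : x / 200 ≤ Real.exp (x / 200) := by linarith [Real.add_one_le_exp (x / 200)]
    have h2 : Real.exp (x / 100) = Real.exp (x / 200) * Real.exp (x / 200) := by
      rw [← Real.exp_add]; congr 1; ring
    rw [h2]
    nlinarith
  rw [Real.rpow_def_of_pos hn0, ← hx] at hk1 hk2
  have hk0 : (0 : ℝ) < k := (Real.exp_pos _).trans_le hk1
  by_contra hcon
  rw [ge_iff_le, not_le] at hcon
  have hα0 : ∀ i, 0 < α i := fun i => (Real.rpow_pos_of_pos hn0 _).trans_le (hα i).1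
  have hs1 : 0 ≤ ∑ i ∈ Finset.univ.filter (fun i => α i ≤ 1), (α i) ^ 2 :=
    Finset.sum_nonneg fun _ _ => sq_nonneg _
  have hs2 : 0 ≤ ∑ i ∈ Finset.univ.filter (fun i => 1 < α i), α i :=
    Finset.sum_nonneg fun i _ => (hα0 i).le
  have hsq : ∑ i ∈ Finset.univ.filter (fun i => α i ≤ 1), (α i) ^ 2 ≤ 1 / 10000 * k * x := by
    linarith
  have hlin : ∑ i ∈ Finset.univ.filter (fun i => 1 < α i), α i ≤ 1 / 10000 * k * x := by
    linarith
  obtain ⟨V, W, hV, hW, hno⟩ := hstrong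
  set D := ⌈2 * (1 / 10000) * x⌉₊ with hD
  have hD1 : 2 * (1 / 10000) * x ≤ D := Nat.le_ceil _
  have hD2 : (D : ℝ) ≤ 2 * (1 / 10000) * x + 1 := (Nat.ceil_lt_add_one (by linarith)).le
  have h2D : (2 : ℝ) ^ D ≤ 4 * Real.exp (2 / 10000 * x) := by
    have h2 : (2 : ℝ) ≤ Real.exp 1 := by linarith [Real.add_one_le_exp (1 : ℝ)]
    calc (2 : ℝ) ^ D ≤ Real.exp 1 ^ D := by gcongr
      _ = Real.exp D := by rw [← Real.exp_nat_mul, mul_one]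
      _ ≤ Real.exp (1 + 2 / 10000 * x) := Real.exp_le_exp.2 (by linarith)
      _ = Real.exp 1 * Real.exp (2 / 10000 * x) := Real.exp_add _ _
      _ ≤ _ := by gcongr; linarith [Real.exp_one_lt_d9]
  have hM : ∀ i, (ns i : ℝ) ≤ Real.exp (91 / 100 * x) := by
    intro i
    rw [hns i]
    have h1 := (hα i).2
    rw [Real.rpow_def_of_pos hn0, ← hx] at h1
    calc α i * (n / k) ≤ Real.exp (x * (1 / 100)) * (Real.exp x / Real.exp (x * (1 / 10))) := by
          rw [← hexp]
          gcongr
      _ = Real.exp (91 / 100 * x) := by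
          rw [← Real.exp_sub, ← Real.exp_add]; congr 1; ring
  have hsumI : ∑ i ∈ Finset.univ.filter (fun i => 1 < α i), (ns i : ℝ) ≤ D * n / 2 := by
    simp_rw [hns]
    rw [← Finset.sum_mul]
    calc _ ≤ (1 / 10000 * k * x) * ((n : ℝ) / k) := by gcongr
      _ = (2 * (1 / 10000) * x) * n / 2 := by field_simp
      _ ≤ _ := by gcongr
  -- `n / 2 / 2 ^ D / 4` is a power of `n` with exponent close to `1`
  have hsize : Real.exp (9996 / 10000 * x) / 32 ≤ (n : ℝ) / 2 / 2 ^ D / 2 / 2 := by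
    calc Real.exp (9996 / 10000 * x) / 32
        ≤ Real.exp (x - 2 / 10000 * x) / 32 := by
          gcongr; linarith
      _ = (n : ℝ) / 2 / (4 * Real.exp (2 / 10000 * x)) / 2 / 2 := by
          rw [Real.exp_sub, hexp]; field_simp; norm_num
      _ ≤ _ := by gcongr
  have hkk : (k : ℝ) ≤ Real.exp (-(256 / 10000 * x)) * (Real.exp (9996 / 10000 * x) / 32) := by
    calc (k : ℝ) ≤ Real.exp (9 / 10 * x) := by rwa [mul_comm] at hk2
      _ = Real.exp (9 / 10 * x) * 32 / 32 := by field_simp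
      _ ≤ Real.exp (9 / 10 * x) * Real.exp (x / 100) / 32 := by gcongr; linarith
      _ = Real.exp (91 / 100 * x) / 32 := by rw [← Real.exp_add]; ring_nf
      _ ≤ Real.exp (-(256 / 10000 * x) + 9996 / 10000 * x) / 32 := by gcongr; linarith
      _ = _ := by rw [Real.exp_add]; ring
  have hxk : x ≤ k := hxexp.trans (le_trans (Real.exp_le_exp.2 (by linarith)) hk1)
  refine hno (hasBipIndepSet_of_few_bicliques V W (Finset.univ.filter (fun i => 1 < α i)) D
    (Real.exp (91 / 100 * x)) (4 * (1 / 10000) * x / k) (by exact_mod_cast hn0)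
    (Real.exp_pos _).le (by positivity) (fun i _ => by rw [hV]; exact hM i)
    (fun i _ => by rw [hW]; exact hM i) (by simpa only [hV] using hsumI)
    (by simpa only [hW] using hsumI) ?_ ?_ ?_ ?_ ?_)
  · have hc : (Finset.univ.filter (fun i => 1 < α i))ᶜ =
        Finset.univ.filter (fun i => α i ≤ 1) := by
      ext i; simp
    rw [hc]
    simp_rw [hV, hW, hns]
    calc ∑ i ∈ Finset.univ.filter (fun i => α i ≤ 1), α i * ((n : ℝ) / k) * (α i * (n / k))
        = (∑ i ∈ Finset.univ.filter (fun i => α i ≤ 1), (α i) ^ 2) * ((n : ℝ) / k) ^ 2 := by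
          rw [Finset.sum_mul]
          exact Finset.sum_congr rfl fun i _ => by ring
      _ ≤ (1 / 10000 * k * x) * ((n : ℝ) / k) ^ 2 := by gcongr
      _ = _ := by field_simp; norm_num
  · have hDx : (D : ℝ) ≤ Real.exp (x / 100) := by linarith
    have h1 : (1 : ℝ) ≤ Real.exp (92 / 100 * x) := Real.one_le_exp (by linarith)
    calc 32 * (1 + D * Real.exp (91 / 100 * x)) * 2 ^ D
        ≤ 32 * (Real.exp (92 / 100 * x) + Real.exp (x / 100) * Real.exp (91 / 100 * x)) *
          (4 * Real.exp (2 / 10000 * x)) := by gcongr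
      _ = 512 * Real.exp (92 / 100 * x + 2 / 10000 * x) / 2 := by
          rw [← Real.exp_add, show x / 100 + 91 / 100 * x = 92 / 100 * x by ring, Real.exp_add]
          ring
      _ ≤ Real.exp (x / 100) * Real.exp (92 / 100 * x + 2 / 10000 * x) / 2 := by
          gcongr; linarith
      _ ≤ (n : ℝ) / 2 := by
          rw [← Real.exp_add, ← hexp]
          gcongr
          linarith
  · rw [← mul_div_assoc, div_le_one hk0]
    linarith
  · have h1 : Real.exp (-(256 / 10000 * x)) ≤ 1 := Real.exp_le_one_iff.2 (by linarith)
    have h2 : (k : ℝ) ≤ Real.exp (9996 / 10000 * x) / 32 := by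
      refine hkk.trans (mul_le_of_le_one_left (by positivity) h1)
    have h3 := h2.trans hsize
    linarith
  · refine hkk.trans (mul_le_mul ?_ hsize (by positivity) ?_)
    · have hy : 32 * (4 * (1 / 10000) * x / k) ≤ 1 / 2 := by
        rw [← mul_div_assoc, div_le_iff₀ hk0]
        linarith
      calc Real.exp (-(256 / 10000 * x))
          = Real.exp (-(2 * (32 * (4 * (1 / 10000) * x / k)))) ^ k := by
            rw [← Real.exp_nat_mul]
            congr 1
            field_simp
            norm_num
        _ ≤ _ := by
            gcongr
            exact exp_neg_two_mul_le_one_sub_s7 (by positivity) hy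
    · apply pow_nonneg
      rw [sub_nonneg, ← mul_div_assoc, div_le_one hk0]
      linarith
end

section
/- There exists a constant C > 0 such that the following holds for all sufficiently large n: suppose n^{1/10} ≤ k ≤ n^{9/10}, and let α_1, …, α_r and β_1, …, β_r be reals with α_i, β_i ∈ [n^{-1/100}, n^{1/100}] for each i, such that m_i := α_i · (n/k) and n_i := β_i · (n/k) are positive integers for each i. Set p_i = α_i/(α_i + β_i) and let H(p) = −p log p − (1−p) log(1−p) be the binary entropy function. If for every subset X ⊆ {1, 2, …, r} we have ∑_{i ∈ X} α_i β_i + ∑_{i ∉ X} (α_i + β_i) H(p_i) ≥ C · k · log n, then the sequence of pairs ((m_1, n_1), (m_2, n_2), …, (m_r, n_r)) is (n, k)-strong. -/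
/-- The sequence of pairs `((ms 0, ns 0), …, (ms (r-1), ns (r-1)))` is
`(n, k)`-strong: there is a bipartite graph `G = (V, W, E)` with `|V| = |W| = n`
that is the union of complete bipartite graphs `G_i = (V_i, W_i, V_i × W_i)` with
`|V_i| = ms i` and `|W_i| = ns i`, and `G` has no bipartite independent set of size
`k × k`. -/
def IsStrongPairs (n k r : ℕ) (ms ns : Fin r → ℕ) : Prop :=
  ∃ V W : Fin r → Finset (Fin n),
    (∀ i, (V i).card = ms i) ∧ (∀ i, (W i).card = ns i) ∧
    ¬ HasBipIndepSet n k
      ((Finset.univ : Finset (Fin n × Fin n)).filter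
        (fun p => ∃ i, p.1 ∈ V i ∧ p.2 ∈ W i))

/-- The binary entropy function `H(p) = -p log p - (1-p) log (1-p)`. -/
noncomputable def binEnt (p : ℝ) : ℝ := -p * Real.log p - (1 - p) * Real.log (1 - p)

section

open Finset

/-- Averaging: among all sets of at most `m` points, some set is disjoint from few (in weight)
of the `k`-sets `T p`. -/
lemma exists_card_le_sum_disjoint_le {P : Type*} {n k : ℕ} (hn : 0 < n) (hk : k ≤ n)
    (A : Finset P) (c : P → ℝ) (T : P → Finset (Fin n))
    (hT : ∀ p ∈ A, (T p).card = k) (m : ℕ) :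
    ∃ W : Finset (Fin n), W.card ≤ m ∧
      ∑ p ∈ A with Disjoint W (T p), c p ≤ (1 - (k : ℝ) / n) ^ m * ∑ p ∈ A, c p := by
  have hn' : (0 : ℝ) < n := by exact_mod_cast hn
  induction m with
  | zero => exact ⟨∅, by simp, by simp⟩
  | succ m ih =>
    obtain ⟨W, hW, hsum⟩ := ih
    set A' := A.filter (fun p => Disjoint W (T p)) with hA'
    have key : ∃ w ∈ (univ : Finset (Fin n)), ∑ p ∈ A' with w ∉ T p, c p ≤
        (1 - (k : ℝ) / n) * ∑ p ∈ A', c p := by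
      apply exists_le_of_sum_le ⟨⟨0, hn⟩, mem_univ _⟩
      simp_rw [sum_filter]
      rw [sum_comm, sum_const, card_univ, Fintype.card_fin, nsmul_eq_mul]
      apply le_of_eq
      rw [← mul_assoc, mul_sum]
      refine sum_congr rfl fun p hp => ?_
      rw [← sum_filter, sum_const, nsmul_eq_mul]
      congr 1
      have : (univ.filter (fun w => w ∉ T p)) = (T p)ᶜ := by ext; simp
      rw [this, card_compl, hT p (mem_filter.1 hp).1, Fintype.card_fin, Nat.cast_sub hk]
      field_simp
    obtain ⟨w, -, hw⟩ := key
    refine ⟨insert w W, (card_insert_le _ _).trans (by omega), ?_⟩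
    have h1 : A.filter (fun p => Disjoint (insert w W) (T p)) = A'.filter (fun p => w ∉ T p) := by
      ext p; simp [hA', disjoint_insert_left]; tauto
    rw [h1, pow_succ, mul_right_comm, mul_comm _ (1 - (k : ℝ) / n)]
    refine hw.trans (mul_le_mul_of_nonneg_left hsum ?_)
    rw [sub_nonneg, div_le_one hn']
    exact_mod_cast hk

/-- Given the sets `V i`, the sets `W i` can be chosen so that the number of pairs
`(S p, T p)` joined by no `V i × W i` is at most its expected value. -/
lemma exists_card_filter_le_sum_prod {P ι : Type*} [DecidableEq ι] {n k : ℕ} (hn : 0 < n)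
    (hk : k ≤ n) (S T : P → Finset (Fin n)) (V : ι → Finset (Fin n)) (ns : ι → ℕ)
    (G : Finset ι) (A : Finset P) (hT : ∀ p ∈ A, (T p).card = k) :
    ∃ W : ι → Finset (Fin n), (∀ i, (W i).card ≤ ns i) ∧
      (#{p ∈ A | ∀ i ∈ G, Disjoint (V i) (S p) ∨ Disjoint (W i) (T p)} : ℝ) ≤
        ∑ p ∈ A, ∏ i ∈ G, if Disjoint (V i) (S p) then 1 else (1 - (k : ℝ) / n) ^ ns i := by
  induction G using Finset.induction_on generalizing A with
  | empty => exact ⟨fun _ => ∅, by simp, by simp⟩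
  | insert a G ha ih =>
    set d : P → ℝ := fun p => ∏ i ∈ G, if Disjoint (V i) (S p) then 1 else
      (1 - (k : ℝ) / n) ^ ns i with hd
    obtain ⟨Wa, hWa, h1⟩ := exists_card_le_sum_disjoint_le hn hk
      (A.filter fun p => ¬ Disjoint (V a) (S p)) d T (fun p hp => hT p (mem_filter.1 hp).1) (ns a)
    obtain ⟨W, hW, h2⟩ := ih (A.filter fun p => Disjoint (V a) (S p) ∨ Disjoint Wa (T p))
      (fun p hp => hT p (mem_filter.1 hp).1)
    refine ⟨Function.update W a Wa, fun i => ?_, ?_⟩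
    · by_cases h : i = a
      · subst h; simpa using hWa
      · simpa [h] using hW i
    have h3 : {p ∈ A | ∀ i ∈ insert a G, Disjoint (V i) (S p) ∨
        Disjoint (Function.update W a Wa i) (T p)} =
        {p ∈ (A.filter fun p => Disjoint (V a) (S p) ∨ Disjoint Wa (T p)) |
          ∀ i ∈ G, Disjoint (V i) (S p) ∨ Disjoint (W i) (T p)} := by
      ext p
      simp only [mem_filter, forall_mem_insert, Function.update_self, and_assoc]
      refine and_congr_right fun _ => and_congr_right fun _ => forall₂_congr fun i hi => ?_
      have hne : i ≠ a := fun h => ha (h ▸ hi)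
      rw [Function.update_of_ne hne]
    rw [h3]
    refine h2.trans ?_
    simp_rw [prod_insert ha]
    change ∑ p ∈ _, d p ≤ ∑ p ∈ A, _ * d p
    rw [filter_filter, sum_filter] at h1
    rw [sum_filter] at h1 ⊢
    rw [mul_sum] at h1
    have h4 : ∑ p ∈ A, (if Disjoint (V a) (S p) ∨ Disjoint Wa (T p) then d p else 0) =
        ∑ p ∈ A, (if Disjoint (V a) (S p) then d p else 0) +
        ∑ p ∈ A, (if ¬Disjoint (V a) (S p) ∧ Disjoint Wa (T p) then d p else 0) := by
      rw [← sum_add_distrib]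
      refine sum_congr rfl fun p _ => ?_
      by_cases h : Disjoint (V a) (S p) <;> simp [h]
    rw [h4]
    refine (add_le_add_right h1 _).trans (le_of_eq ?_)
    rw [← sum_add_distrib]
    refine sum_congr rfl fun p _ => ?_
    by_cases h : Disjoint (V a) (S p) <;> simp [h]

/-- For `j` independent uniform points, the expectation of the product of `x i` over the blocks
`B i` that are hit (those in `I` counting as hit already). -/
lemma sum_prod_hit_le {ι : Type*} [DecidableEq ι] {n : ℕ} (B : ι → Finset (Fin n))
    (x : ι → ℝ) (G : Finset ι) {y τ ε : ℝ} (hx0 : ∀ i ∈ G, 0 ≤ x i) (hxy : ∀ i ∈ G, x i ≤ y)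
    (hy : y ≤ 1) (hε : 0 ≤ ε)
    (hB : ∀ I ⊆ G, ε < ∏ i ∈ I, x i → (1 - τ) * n ≤ #{p : Fin n | ∃ i ∈ G \ I, p ∈ B i})
    (hq0 : 0 ≤ 1 - (1 - τ) * (1 - y)) (j : ℕ) (I : Finset ι) (hI : I ⊆ G) :
    ∑ g : Fin j → Fin n, ∏ i ∈ G, (if i ∉ I ∧ ∀ a, g a ∉ B i then 1 else x i) ≤
      (n : ℝ) ^ j * ((1 - (1 - τ) * (1 - y)) ^ j * ∏ i ∈ I, x i + ε) := by
  have hx1 : ∀ i ∈ G, x i ≤ 1 := fun i hi => (hxy i hi).trans hy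
  set q := 1 - (1 - τ) * (1 - y) with hq
  have hif : ∀ J ⊆ G, ∏ i ∈ G, (if i ∉ J then 1 else x i) = ∏ i ∈ J, x i := by
    intro J hJ
    rw [← prod_filter_mul_prod_filter_not G (fun i => i ∉ J), prod_congr rfl (g := fun _ => 1)]
    · rw [prod_const_one, one_mul]
      have : G.filter (fun i => ¬ i ∉ J) = J := by
        ext i; simp; exact fun h => hJ h
      rw [this]
      exact prod_congr rfl fun i hi => by simp [hi]
    · intro i hi; simp [(mem_filter.1 hi).2]
  induction j generalizing I with
  | zero =>
    simp only [pow_zero, one_mul, univ_unique, sum_singleton, IsEmpty.forall_iff, and_true]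
    rw [hif I hI]
    linarith
  | succ j ih =>
    have hX0 : 0 ≤ ∏ i ∈ I, x i := prod_nonneg fun i hi => hx0 i (hI hi)
    by_cases hlt : ε < ∏ i ∈ I, x i
    · have hstep : ∑ g : Fin (j + 1) → Fin n,
          ∏ i ∈ G, (if i ∉ I ∧ ∀ a, g a ∉ B i then 1 else x i) =
          ∑ p : Fin n, ∑ g : Fin j → Fin n,
            ∏ i ∈ G, (if i ∉ I ∪ {i ∈ G | p ∈ B i} ∧ ∀ a, g a ∉ B i then 1 else x i) := by
        rw [← (Fin.consEquiv (fun _ : Fin (j + 1) => Fin n)).sum_comp, Fintype.sum_prod_type]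
        refine sum_congr rfl fun p _ => sum_congr rfl fun g _ => prod_congr rfl fun i hi => ?_
        refine if_congr ?_ rfl rfl
        simp [Fin.consEquiv, Fin.forall_fin_succ, hi, and_assoc]
      rw [hstep]
      have hbound : ∀ p : Fin n, ∑ g : Fin j → Fin n,
            ∏ i ∈ G, (if i ∉ I ∪ {i ∈ G | p ∈ B i} ∧ ∀ a, g a ∉ B i then 1 else x i) ≤
          (n : ℝ) ^ j * (q ^ j * ((∏ i ∈ I, x i) *
            (1 - (1 - y) * if ∃ i ∈ G \ I, p ∈ B i then 1 else 0)) + ε) := by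
        intro p
        have hsub : I ∪ {i ∈ G | p ∈ B i} ⊆ G := union_subset hI (filter_subset _ _)
        refine (ih _ hsub).trans ?_
        gcongr
        split_ifs with h
        · obtain ⟨i, hi, hpi⟩ := h
          obtain ⟨hiG, hiI⟩ := mem_sdiff.1 hi
          have : insert i I ⊆ I ∪ {i ∈ G | p ∈ B i} := by
            intro l hl
            rcases mem_insert.1 hl with rfl | hl
            · simp [hiG, hpi]
            · simp [hl]
          calc ∏ i ∈ I ∪ {i ∈ G | p ∈ B i}, x i ≤ ∏ i ∈ insert i I, x i :=
                prod_le_prod_of_subset_of_le_one this (fun l hl => hx0 l (hsub hl))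
                  (fun l hl _ => hx1 l (hsub hl))
            _ = x i * ∏ i ∈ I, x i := prod_insert hiI
            _ ≤ y * ∏ i ∈ I, x i := mul_le_mul_of_nonneg_right (hxy i hiG) hX0
            _ = _ := by ring
        · rw [mul_zero, sub_zero, mul_one]
          exact prod_le_prod_of_subset_of_le_one subset_union_left (fun l hl => hx0 l (hsub hl))
                  (fun l hl _ => hx1 l (hsub hl))
      refine (sum_le_sum fun p _ => hbound p).trans ?_
      rw [← mul_sum, sum_add_distrib, ← mul_sum, ← mul_sum, sum_sub_distrib, ← mul_sum,
        sum_boole]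
      simp only [sum_const, card_univ, Fintype.card_fin, nsmul_eq_mul, mul_one]
      have h5 := hB I hI hlt
      have h6 : (n : ℝ) - (1 - y) * #{p : Fin n | ∃ i ∈ G \ I, p ∈ B i} ≤ n * q := by
        rw [hq]; nlinarith
      calc _ ≤ (n : ℝ) ^ j * (q ^ j * ((∏ i ∈ I, x i) * (n * q)) + n * ε) := by gcongr
        _ = _ := by ring
    · calc ∑ g : Fin (j + 1) → Fin n, ∏ i ∈ G, (if i ∉ I ∧ ∀ a, g a ∉ B i then 1 else x i)
          ≤ ∑ g : Fin (j + 1) → Fin n, ∏ i ∈ I, x i := by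
            refine sum_le_sum fun g _ => ?_
            rw [← hif I hI]
            refine prod_le_prod (fun i hi => ?_) (fun i hi => ?_)
            · split_ifs
              exacts [zero_le_one, hx0 i hi]
            · by_cases h : i ∈ I
              · simp [h]
              · simp only [h, not_false_eq_true, true_and, if_true]
                split_ifs
                exacts [le_rfl, hx1 i hi]
        _ = (n : ℝ) ^ (j + 1) * ∏ i ∈ I, x i := by simp
        _ ≤ _ := by
            gcongr
            have : 0 ≤ q ^ (j + 1) * ∏ i ∈ I, x i := by positivity
            linarith

/-- Restricting a uniform permutation to `k` points: comparison with `k` independent points. -/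
lemma sum_perm_comp_le {n k : ℕ} (s : Fin k → Fin n) (hs : Function.Injective s)
    (F : (Fin k → Fin n) → ℝ) (hF : ∀ g, 0 ≤ F g) :
    ∑ σ : Equiv.Perm (Fin n), F (σ ∘ s) ≤ (n - k).factorial * ∑ g, F g := by
  classical
  rw [← sum_fiberwise univ (fun σ : Equiv.Perm (Fin n) => (σ ∘ s : Fin k → Fin n)), mul_sum]
  refine sum_le_sum fun g _ => ?_
  rw [sum_congr rfl (g := fun _ => F g) (fun σ hσ => by rw [(mem_filter.1 hσ).2]), sum_const,
    nsmul_eq_mul]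
  refine mul_le_mul_of_nonneg_right ?_ (hF g)
  norm_cast
  rcases (univ.filter fun σ : Equiv.Perm (Fin n) => (σ ∘ s : Fin k → Fin n) = g).eq_empty_or_nonempty
    with h | ⟨σ₀, hσ₀⟩
  · simp [h]
  have hσ₀' := (mem_filter.1 hσ₀).2
  have hcard : Fintype.card {σ : Equiv.Perm (Fin n) // ∀ a, ¬ a ∉ Set.range s → σ a = a} =
      (n - k).factorial := by
    rw [← Fintype.card_congr (Equiv.Perm.subtypeEquivSubtypePerm (fun a => a ∉ Set.range s)),
      Fintype.card_perm, Fintype.card_subtype_compl]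
    congr 2
    · simp
    · rw [Set.card_range_of_injective hs, Fintype.card_fin]
  rw [← hcard, Fintype.card_subtype]
  refine card_le_card_of_injOn (fun σ => σ₀⁻¹ * σ) (fun σ hσ => ?_) (fun σ _ σ' _ h => by simpa using h)
  have hσ' := (mem_filter.1 hσ).2
  simp only [coe_filter, mem_univ, true_and, Set.mem_ofPred_eq, not_not]
  rintro _ ⟨b, rfl⟩
  have := congrFun (hσ'.trans hσ₀'.symm) b
  simp only [Function.comp_apply] at this
  simp [this]

/-- Disjoint blocks of prescribed sizes. -/
lemma exists_pairwiseDisjoint_card_eq {ι : Type*} [DecidableEq ι] {n : ℕ} (m : ι → ℕ)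
    (G : Finset ι) (h : ∑ i ∈ G, m i ≤ n) :
    ∃ B : ι → Finset (Fin n), (∀ i ∈ G, (B i).card = m i) ∧
      (G : Set ι).PairwiseDisjoint B := by
  induction G using Finset.induction_on with
  | empty => exact ⟨fun _ => ∅, by simp, by simp⟩
  | insert a G ha ih =>
    rw [sum_insert ha] at h
    obtain ⟨B, hB, hd⟩ := ih (by omega)
    obtain ⟨D, hD, hDc⟩ := exists_subset_card_eq (s := (G.biUnion B)ᶜ) (n := m a) (by
      have : G.sum m = ∑ i ∈ G, m i := rfl
      rw [card_compl, card_biUnion hd, sum_congr rfl hB, Fintype.card_fin]; omega)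
    have hne : ∀ i ∈ G, i ≠ a := fun i hi h => ha (h ▸ hi)
    refine ⟨Function.update B a D, ?_, ?_⟩
    · intro i hi
      rcases mem_insert.1 hi with rfl | hi
      · simpa using hDc
      · simpa [hne i hi] using hB i hi
    · rw [coe_insert, Set.pairwiseDisjoint_insert_of_notMem (by simpa using ha)]
      refine ⟨fun i hi j hj hij => ?_, fun j hj => ?_⟩
      · simpa [Function.onFun, hne i hi, hne j hj] using hd hi hj hij
      · rw [Function.update_self, Function.update_of_ne (hne j hj)]
        refine disjoint_left.2 fun z hz hz' => ?_
        exact mem_compl.1 (hD hz) (mem_biUnion.2 ⟨j, hj, hz'⟩)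

/-- Sets `V i` in random position and random sets `W i` in a group `G`, in terms of a bound
`τ` on the fraction of points outside blocks not yet hit. -/
lemma exists_group_card_filter_le {P ι : Type*} [DecidableEq ι] {n k : ℕ} (hkn : k < n)
    (S T : P → Finset (Fin n)) (hS : ∀ p, (S p).card = k) (hT : ∀ p, (T p).card = k)
    (ms ns : ι → ℕ) (G : Finset ι) (hms : ∑ i ∈ G, ms i ≤ n) {y τ ε : ℝ}
    (hxy : ∀ i ∈ G, (1 - (k : ℝ) / n) ^ ns i ≤ y) (hy : y ≤ 1) (hε : 0 ≤ ε)
    (hB : ∀ I ⊆ G, ε < ∏ i ∈ I, (1 - (k : ℝ) / n) ^ ns i →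
      (1 - τ) * n ≤ ∑ i ∈ G \ I, (ms i : ℝ))
    (hq0 : 0 ≤ 1 - (1 - τ) * (1 - y)) (A : Finset P) :
    ∃ V W : ι → Finset (Fin n), (∀ i ∈ G, (V i).card = ms i) ∧ (∀ i, (W i).card ≤ ns i) ∧
      (#{p ∈ A | ∀ i ∈ G, Disjoint (V i) (S p) ∨ Disjoint (W i) (T p)} : ℝ) ≤
        #A * (((n : ℝ) / (n - k)) ^ k * ((1 - (1 - τ) * (1 - y)) ^ k + ε)) := by
  have hn : 0 < n := by omega
  have hn' : (0 : ℝ) < n := by exact_mod_cast hn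
  have hkn' : (k : ℝ) < n := by exact_mod_cast hkn
  obtain ⟨B, hBc, hBd⟩ := exists_pairwiseDisjoint_card_eq ms G hms
  set x : ι → ℝ := fun i => (1 - (k : ℝ) / n) ^ ns i with hx
  have hx0 : ∀ i, 0 ≤ x i := fun i => by
    refine pow_nonneg ?_ _
    rw [sub_nonneg, div_le_one hn']
    exact hkn'.le
  set F : (Fin k → Fin n) → ℝ := fun g => ∏ i ∈ G, if ∀ a, g a ∉ B i then 1 else x i with hF
  have hF0 : ∀ g, 0 ≤ F g := fun g => prod_nonneg fun i _ => by
    split_ifs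
    exacts [zero_le_one, hx0 i]
  set q := 1 - (1 - τ) * (1 - y) with hq
  have hiid : ∑ g, F g ≤ (n : ℝ) ^ k * (q ^ k + ε) := by
    have := sum_prod_hit_le B x G (fun i _ => hx0 i) hxy hy hε ?_ hq0 k ∅ (empty_subset _)
    · simpa [hF] using this
    intro I hI hlt
    refine (hB I hI hlt).trans (le_of_eq ?_)
    have : ({p : Fin n | ∃ i ∈ G \ I, p ∈ B i} : Finset (Fin n)) = (G \ I).biUnion B := by
      ext p; simp
    rw [this, card_biUnion (fun i hi j hj => hBd (mem_sdiff.1 hi).1 (mem_sdiff.1 hj).1)]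
    push_cast
    exact sum_congr rfl fun i hi => by rw [hBc i (mem_sdiff.1 hi).1]
  set s : P → Fin k → Fin n := fun p => (S p).orderEmbOfFin (hS p) with hs
  have hfac : ((n - k).factorial : ℝ) * (n : ℝ) ^ k ≤
      n.factorial * ((n : ℝ) / (n - k)) ^ k := by
    rw [div_pow, mul_div_assoc', le_div_iff₀ (by positivity [sub_pos.2 hkn']),
      ← Nat.factorial_mul_descFactorial hkn.le]
    have h1 : ((n : ℝ) - k) ^ k ≤ n.descFactorial k := by
      have h2 : (n - k) ^ k ≤ n.descFactorial k :=
        (Nat.pow_le_pow_left (by omega) k).trans (Nat.pow_sub_le_descFactorial n k)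
      rw [← Nat.cast_sub hkn.le]
      exact_mod_cast h2
    push_cast
    calc _ = ((n - k).factorial : ℝ) * ((n : ℝ) - k) ^ k * (n : ℝ) ^ k := by ring
      _ ≤ _ := by gcongr
  obtain ⟨σ, -, hσ⟩ : ∃ σ ∈ (univ : Finset (Equiv.Perm (Fin n))), ∑ p ∈ A, F (σ ∘ s p) ≤
      #A * (((n : ℝ) / (n - k)) ^ k * (q ^ k + ε)) := by
    apply exists_le_of_sum_le univ_nonempty
    rw [sum_comm, sum_const, card_univ, Fintype.card_perm, Fintype.card_fin, nsmul_eq_mul]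
    calc ∑ p ∈ A, ∑ σ : Equiv.Perm (Fin n), F (σ ∘ s p)
        ≤ ∑ p ∈ A, (n.factorial * ((n : ℝ) / (n - k)) ^ k) * (q ^ k + ε) := by
          refine sum_le_sum fun p _ => ?_
          refine (sum_perm_comp_le (s p) ((S p).orderEmbOfFin (hS p)).injective F hF0).trans ?_
          refine (mul_le_mul_of_nonneg_left hiid (by positivity)).trans ?_
          rw [← mul_assoc]
          exact mul_le_mul_of_nonneg_right hfac (by positivity)
      _ = _ := by rw [sum_const, nsmul_eq_mul]; ring
  set V : ι → Finset (Fin n) := fun i => (B i).map σ.symm.toEmbedding with hV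
  obtain ⟨W, hW, hcard⟩ := exists_card_filter_le_sum_prod hn hkn.le S T V ns G A (fun p _ => hT p)
  refine ⟨V, W, fun i hi => by rw [hV, card_map, hBc i hi], hW, hcard.trans (le_trans ?_ hσ)⟩
  refine le_of_eq (sum_congr rfl fun p _ => prod_congr rfl fun i _ => if_congr ?_ rfl rfl)
  have hr : ∀ z, z ∈ S p ↔ ∃ a, s p a = z := fun z => by
    rw [← mem_coe, ← range_orderEmbOfFin (S p) (hS p)]
    rfl
  rw [disjoint_right]
  simp only [hr, forall_exists_index, forall_apply_eq_imp_iff, hV, mem_map_equiv, Equiv.symm_symm,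
    Function.comp_apply]

/-- The choice of the threshold `t` for the fraction of points lying in blocks already hit. -/
lemma exists_threshold {u Γ η : ℝ} (hu : 100 ≤ u) (hΓ : 0 < Γ) (hη : 0 ≤ η) (hηu : η * u ≤ 1)
    (hΓu : Real.exp (Γ - 1) ≤ u ^ 2) :
    ∃ t R : ℝ, 0 < R ∧ R ≤ max 1 (Real.exp (Γ - 1)) ∧ Γ / 24 ≤ R * t ∧ 0 ≤ t ∧ t + η ≤ 1 ∧
      1 - (1 - (t + η)) * (1 - Real.exp (-Γ)) ≤ Real.exp (-(Γ / 24)) := by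
  have hη' : η ≤ 1 / 4 := by nlinarith
  have hy0 := Real.exp_pos (-Γ)
  rcases le_total 5 Γ with h5 | h5
  · set t := Real.exp (-((Γ - 1) / 2)) with ht
    have ht0 : 0 < t := Real.exp_pos _
    have hRt : Real.exp (Γ - 1) * t = Real.exp ((Γ - 1) / 2) := by
      rw [ht, ← Real.exp_add]; ring_nf
    have htinv : Real.exp ((Γ - 1) / 2) * t = 1 := by
      rw [ht, ← Real.exp_add]; simp
    have hsq : Real.exp ((Γ - 1) / 2) ≤ u := by
      rw [← pow_le_pow_iff_left₀ (Real.exp_pos _).le (by linarith) two_ne_zero,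
        ← Real.exp_nat_mul]
      refine le_trans (le_of_eq ?_) hΓu
      congr 1
      push_cast
      ring
    have hηt : η ≤ t := by
      have : 1 ≤ u * t := by rw [← htinv]; gcongr
      nlinarith
    have hlin := Real.add_one_le_exp ((Γ - 1) / 2)
    have ht3 : 3 * t ≤ 1 := by nlinarith
    refine ⟨t, Real.exp (Γ - 1), Real.exp_pos _, le_max_right _ _, ?_, ht0.le, by linarith, ?_⟩
    · rw [hRt]; linarith
    · have hyt : Real.exp (-Γ) ≤ t := Real.exp_le_exp.2 (by linarith)
      have h3 : (3 : ℝ) ≤ Real.exp (11 * Γ / 24 - 1 / 2) := by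
        have := Real.quadratic_le_exp_of_nonneg (x := 11 * Γ / 24 - 1 / 2) (by linarith)
        nlinarith
      have h4 : Real.exp (11 * Γ / 24 - 1 / 2) * t = Real.exp (-(Γ / 24)) := by
        rw [ht, ← Real.exp_add]; ring_nf
      rw [← h4]
      nlinarith
  · refine ⟨1 / 2, 1, one_pos, le_max_left _ _, by linarith, by norm_num, by linarith, ?_⟩
    have h1 : Real.exp (-Γ) * (1 + Γ) ≤ 1 := by
      have := Real.add_one_le_exp Γ
      have h2 : Real.exp (-Γ) * Real.exp Γ = 1 := by rw [← Real.exp_add]; simp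
      nlinarith
    have h2 : Γ / 6 ≤ 1 - Real.exp (-Γ) := by nlinarith
    have h3 := Real.add_one_le_exp (-(Γ / 24))
    nlinarith

/-- The loss from comparing sampling with and without replacement is negligible. -/
lemma pow_mul_pow_add_exp_le {n k : ℕ} {u Γ q : ℝ} (hu : 100 ≤ u) (hn : (n : ℝ) = u ^ 100)
    (hk1 : u ^ 10 ≤ k) (hk2 : (k : ℝ) ≤ u ^ 90) (hΓ : 1 / u ≤ Γ) (hq0 : 0 ≤ q)
    (hq : q ≤ Real.exp (-(Γ / 24))) :
    ((n : ℝ) / (n - k)) ^ k * (q ^ k + Real.exp (-(k * Γ / 24))) ≤ Real.exp (-(k * Γ / 48)) := by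
  have hu0 : 0 < u := by linarith
  have hk0 : (0 : ℝ) < k := lt_of_lt_of_le (by positivity) hk1
  have hn0 : (0 : ℝ) < n := by rw [hn]; positivity
  have hu9 : (200 : ℝ) ≤ u ^ 9 := by
    calc (200 : ℝ) ≤ 100 ^ 9 := by norm_num
      _ ≤ u ^ 9 := by gcongr
  have hkn : (k : ℝ) / n * u ^ 10 ≤ 1 := by
    rw [div_mul_eq_mul_div, div_le_one hn0, hn]
    calc (k : ℝ) * u ^ 10 ≤ u ^ 90 * u ^ 10 := by gcongr
      _ = u ^ 100 := by ring
  have hkn0 : 0 < (k : ℝ) / n := by positivity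
  have hu10 : (200 : ℝ) ≤ u ^ 10 := by
    calc (200 : ℝ) ≤ 100 ^ 10 := by norm_num
      _ ≤ u ^ 10 := by gcongr
  have hkn2 : (k : ℝ) / n ≤ 1 / 2 := by nlinarith
  have hkn' : k < n := by
    have : (k : ℝ) < n := by
      rw [div_le_iff₀ hn0] at hkn2; linarith
    exact_mod_cast this
  have hΓ0 : 0 < Γ := lt_of_lt_of_le (by positivity) hΓ
  have hΓu : 1 ≤ Γ * u := by rwa [div_le_iff₀ hu0] at hΓ
  have h1 : ((n : ℝ) / (n - k)) ^ k ≤ Real.exp (2 * (k / n) * k) := by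
    have h2 : (n : ℝ) / (n - k) ≤ Real.exp (2 * (k / n)) := by
      have h3 : (n : ℝ) - k = n * (1 - k / n) := by field_simp
      rw [h3, div_mul_cancel_left₀ hn0.ne', inv_le_iff_one_le_mul₀ (by linarith)]
      nlinarith [Real.add_one_le_exp (2 * ((k : ℝ) / n))]
    calc ((n : ℝ) / (n - k)) ^ k ≤ Real.exp (2 * (k / n)) ^ k := by
          refine pow_le_pow_left₀ ?_ h2 k
          have : (k : ℝ) < n := by exact_mod_cast hkn'
          exact div_nonneg hn0.le (by linarith)
      _ = _ := by rw [← Real.exp_nat_mul]; ring_nf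
  have h2 : q ^ k + Real.exp (-(k * Γ / 24)) ≤
      Real.exp (1 - k * Γ / 24) := by
    have h3 : q ^ k ≤ Real.exp (-(k * Γ / 24)) := by
      refine (pow_le_pow_left₀ hq0 hq k).trans (le_of_eq ?_)
      rw [← Real.exp_nat_mul]; ring_nf
    have h4 : Real.exp (1 - k * Γ / 24) = Real.exp 1 * Real.exp (-(k * Γ / 24)) := by
      rw [← Real.exp_add]; ring_nf
    have h5 := Real.add_one_le_exp 1
    rw [h4]
    nlinarith [Real.exp_pos (-(k * Γ / 24))]
  have hkΓ : 96 ≤ k * Γ := by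
    have : u ^ 10 ≤ k * Γ * u := by
      calc u ^ 10 ≤ (k : ℝ) := hk1
        _ ≤ k * (Γ * u) := le_mul_of_one_le_right hk0.le hΓu
        _ = _ := by ring
    have : u ^ 9 * u ≤ k * Γ * u := by rw [← pow_succ]; exact this
    have := le_of_mul_le_mul_right this hu0
    linarith
  have hkk : 2 * ((k : ℝ) / n) * k ≤ k * Γ / 96 := by
    have h6 : 192 * ((k : ℝ) / n) ≤ Γ := by
      have h7 : (k : ℝ) / n * u ^ 9 * u ≤ Γ * u := by
        calc (k : ℝ) / n * u ^ 9 * u = (k : ℝ) / n * u ^ 10 := by ring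
          _ ≤ _ := hkn.trans hΓu
      have h8 := le_of_mul_le_mul_right h7 hu0
      nlinarith
    nlinarith
  calc ((n : ℝ) / (n - k)) ^ k * _ ≤ Real.exp (2 * (k / n) * k) * Real.exp (1 - k * Γ / 24) :=
        mul_le_mul h1 h2 (by positivity) (Real.exp_pos _).le
    _ ≤ _ := by
        rw [← Real.exp_add]
        exact Real.exp_le_exp.2 (by linarith)

/-- Few pairs survive a group of blocks covering almost all points, when all members have
`min (β i) (1 + log (β i / α i)) ≥ Γ`. -/
lemma exists_group_card_filter_le_exp {P ι : Type*} [DecidableEq ι] {n k : ℕ} {u Γ : ℝ}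
    (hu : 100 ≤ u) (hn : (n : ℝ) = u ^ 100) (hk1 : u ^ 10 ≤ k) (hk2 : (k : ℝ) ≤ u ^ 90)
    (S T : P → Finset (Fin n)) (hS : ∀ p, (S p).card = k) (hT : ∀ p, (T p).card = k)
    (ms ns : ι → ℕ) (α β : ι → ℝ) (G : Finset ι) (hG : G.Nonempty)
    (hα : ∀ i ∈ G, 0 < α i) (hαβ : ∀ i ∈ G, α i ≤ β i) (hβα : ∀ i ∈ G, β i ≤ u ^ 2 * α i)
    (hms : ∀ i, (ms i : ℝ) = α i * ((n : ℝ) / k)) (hns : ∀ i, (ns i : ℝ) = β i * ((n : ℝ) / k))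
    (hΓ : 1 / u ≤ Γ) (hΓβ : ∀ i ∈ G, Γ ≤ β i)
    (hΓl : ∀ i ∈ G, Γ ≤ 1 + Real.log (β i / α i))
    (hle : ∑ i ∈ G, ms i ≤ n) (hge : (n : ℝ) - u * (n / k) ≤ ∑ i ∈ G, (ms i : ℝ))
    (A : Finset P) :
    ∃ V W : ι → Finset (Fin n), (∀ i ∈ G, (V i).card = ms i) ∧ (∀ i, (W i).card ≤ ns i) ∧
      (#{p ∈ A | ∀ i ∈ G, Disjoint (V i) (S p) ∨ Disjoint (W i) (T p)} : ℝ) ≤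
        #A * Real.exp (-(k * Γ / 48)) := by
  have hu0 : 0 < u := by linarith
  have hk0 : (0 : ℝ) < k := lt_of_lt_of_le (by positivity) hk1
  have hn0 : (0 : ℝ) < n := by rw [hn]; positivity
  have hkn : (k : ℝ) / n * u ^ 10 ≤ 1 := by
    rw [div_mul_eq_mul_div, div_le_one hn0, hn]
    calc (k : ℝ) * u ^ 10 ≤ u ^ 90 * u ^ 10 := by gcongr
      _ = u ^ 100 := by ring
  have hkn0 : 0 < (k : ℝ) / n := by positivity
  have hu10 : (200 : ℝ) ≤ u ^ 10 := by
    calc (200 : ℝ) ≤ 100 ^ 10 := by norm_num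
      _ ≤ u ^ 10 := by gcongr
  have hkn2 : (k : ℝ) / n ≤ 1 / 2 := by nlinarith
  have hkltn : k < n := by
    have : (k : ℝ) < n := by
      rw [div_le_iff₀ hn0] at hkn2; linarith
    exact_mod_cast this
  have hΓ0 : 0 < Γ := lt_of_lt_of_le (by positivity) hΓ
  have hΓu : 1 ≤ Γ * u := by rwa [div_le_iff₀ hu0] at hΓ
  have hexp : ∀ i ∈ G, Real.exp (Γ - 1) ≤ β i / α i := fun i hi => by
    have : 0 < β i / α i := div_pos ((hα i hi).trans_le (hαβ i hi)) (hα i hi)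
    rw [← Real.le_log_iff_exp_le this]
    linarith [hΓl i hi]
  set η := u / k with hη
  have hηu : η * u ≤ 1 := by
    rw [hη, div_mul_eq_mul_div, div_le_one hk0]
    refine le_trans ?_ hk1
    calc u * u = u ^ 2 := by ring
      _ ≤ u ^ 10 := pow_le_pow_right₀ (by linarith) (by norm_num)
  obtain ⟨t, R, hR0, hR, hRt, ht0, htη, hq⟩ := exists_threshold hu hΓ0 (by positivity) hηu (by
    obtain ⟨i, hi⟩ := hG
    refine (hexp i hi).trans ?_
    rw [div_le_iff₀ (hα i hi)]
    exact hβα i hi)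
  have hRβ : ∀ i ∈ G, R * α i ≤ β i := fun i hi => by
    rw [← le_div_iff₀ (hα i hi)]
    refine hR.trans (max_le ?_ (hexp i hi))
    rw [le_div_iff₀ (hα i hi), one_mul]
    exact hαβ i hi
  have hx : ∀ i ∈ G, (1 - (k : ℝ) / n) ^ ns i ≤ Real.exp (-β i) := fun i hi => by
    calc (1 - (k : ℝ) / n) ^ ns i ≤ Real.exp (-((k : ℝ) / n)) ^ ns i :=
          pow_le_pow_left₀ (by linarith) (by linarith [Real.add_one_le_exp (-((k : ℝ) / n))]) _
      _ = Real.exp (-β i) := by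
          rw [← Real.exp_nat_mul, hns]
          congr 1
          field_simp
  have hy1 : Real.exp (-Γ) ≤ 1 := Real.exp_le_one_iff.2 (by linarith)
  have hq0 : 0 ≤ 1 - (1 - (t + η)) * (1 - Real.exp (-Γ)) := by
    have : 0 ≤ η := by positivity
    have := Real.exp_pos (-Γ)
    nlinarith
  have hB : ∀ I ⊆ G, Real.exp (-(k * Γ / 24)) < ∏ i ∈ I, (1 - (k : ℝ) / n) ^ ns i →
      (1 - (t + η)) * n ≤ ∑ i ∈ G \ I, (ms i : ℝ) := by
    intro I hI hlt
    have h1 : ∏ i ∈ I, (1 - (k : ℝ) / n) ^ ns i ≤ Real.exp (-∑ i ∈ I, β i) := by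
      rw [← sum_neg_distrib, Real.exp_sum]
      exact prod_le_prod (fun i _ => pow_nonneg (by linarith) _) (fun i hi => hx i (hI hi))
    have h2 : ∑ i ∈ I, β i < k * Γ / 24 := by
      have := Real.exp_lt_exp.1 (hlt.trans_le h1)
      linarith
    have h3 : R * ∑ i ∈ I, α i ≤ ∑ i ∈ I, β i := by
      rw [mul_sum]
      exact sum_le_sum fun i hi => hRβ i (hI hi)
    have h4 : ∑ i ∈ I, α i ≤ t * k := by
      have : R * ∑ i ∈ I, α i ≤ R * (t * k) := by nlinarith
      exact le_of_mul_le_mul_left this hR0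
    have h5 : ∑ i ∈ I, (ms i : ℝ) ≤ t * n := by
      simp_rw [hms]
      rw [← sum_mul]
      calc _ ≤ t * k * ((n : ℝ) / k) := by gcongr
        _ = _ := by field_simp
    have h6 := sum_sdiff (f := fun i => (ms i : ℝ)) hI
    have h7 : u * ((n : ℝ) / k) = η * n := by rw [hη]; ring
    linarith
  obtain ⟨V, W, hV, hW, hcard⟩ := exists_group_card_filter_le hkltn S T hS hT ms ns G hle
    (y := Real.exp (-Γ)) (τ := t + η) (ε := Real.exp (-(k * Γ / 24)))
    (fun i hi => (hx i hi).trans (Real.exp_le_exp.2 (by linarith [hΓβ i hi]))) hy1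
    (Real.exp_pos _).le hB hq0 A
  refine ⟨V, W, hV, hW, hcard.trans ?_⟩
  exact mul_le_mul_of_nonneg_left (pow_mul_pow_add_exp_le hu hn hk1 hk2 hΓ hq0 hq)
    (Nat.cast_nonneg _)

/-- Greedy packing: a set of indices with largest `γ` whose total size is maximal below `n`. -/
lemma exists_top_subset {ι : Type*} [DecidableEq ι] (s : Finset ι) (γ : ι → ℝ) (m : ι → ℕ)
    {n : ℕ} (hs : n < ∑ i ∈ s, m i) :
    ∃ G ⊆ s, ∑ i ∈ G, m i ≤ n ∧ (∃ j ∈ s, n < ∑ i ∈ G, m i + m j) ∧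
      ∀ i ∈ G, ∀ j ∈ s \ G, γ j ≤ γ i := by
  classical
  obtain ⟨G, hG, hmax⟩ := exists_max_image
    (s.powerset.filter fun G => ∑ i ∈ G, m i ≤ n ∧ ∀ i ∈ G, ∀ j ∈ s \ G, γ j ≤ γ i) card
    ⟨∅, by simp⟩
  simp only [mem_filter, mem_powerset] at hG hmax
  obtain ⟨hGs, hGn, hGγ⟩ := hG
  have hne : (s \ G).Nonempty := by
    rw [sdiff_nonempty]
    exact fun h => absurd (sum_le_sum_of_subset (f := m) h) (by omega)
  obtain ⟨j, hj, hjmax⟩ := exists_max_image (s \ G) γ hne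
  obtain ⟨hjs, hjG⟩ := mem_sdiff.1 hj
  refine ⟨G, hGs, hGn, ⟨j, hjs, ?_⟩, hGγ⟩
  by_contra hcon
  have := hmax (insert j G) ⟨insert_subset hjs hGs, by rw [sum_insert hjG]; omega, ?_⟩
  · rw [card_insert_of_notMem hjG] at this
    omega
  · intro i hi l hl
    have hl' : l ∈ s \ G := by
      rw [mem_sdiff] at hl ⊢
      exact ⟨hl.1, fun h => hl.2 (mem_insert_of_mem h)⟩
    rcases mem_insert.1 hi with rfl | hi
    · exact hjmax l hl'
    · exact hGγ i hi l hl'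

/-- Few pairs survive the whole family: the indices are packed greedily into groups. -/
lemma exists_card_filter_le_exp {P ι : Type*} [DecidableEq ι] {n k : ℕ} {u : ℝ}
    (hu : 100 ≤ u) (hn : (n : ℝ) = u ^ 100) (hk1 : u ^ 10 ≤ k) (hk2 : (k : ℝ) ≤ u ^ 90)
    (S T : P → Finset (Fin n)) (hS : ∀ p, (S p).card = k) (hT : ∀ p, (T p).card = k)
    (ms ns : ι → ℕ) (α β : ι → ℝ)
    (hms : ∀ i, (ms i : ℝ) = α i * ((n : ℝ) / k)) (hns : ∀ i, (ns i : ℝ) = β i * ((n : ℝ) / k))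
    (s : Finset ι) (hα : ∀ i ∈ s, 1 / u ≤ α i) (hαβ : ∀ i ∈ s, α i ≤ β i)
    (hβ : ∀ i ∈ s, β i ≤ u) (Γ : ℝ) (hΓ : 0 ≤ Γ)
    (hγ : ∀ i ∈ s, min (β i) (1 + Real.log (β i / α i)) ≤ Γ) (A : Finset P) :
    ∃ V W : ι → Finset (Fin n), (∀ i ∈ s, (V i).card ≤ ms i) ∧ (∀ i ∈ s, (W i).card ≤ ns i) ∧
      (#{p ∈ A | ∀ i ∈ s, Disjoint (V i) (S p) ∨ Disjoint (W i) (T p)} : ℝ) ≤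
        #A * Real.exp
          (-((∑ i ∈ s, α i * min (β i) (1 + Real.log (β i / α i)) - k * Γ) / 48)) := by
  have hu0 : 0 < u := by linarith
  have hk0 : (0 : ℝ) < k := lt_of_lt_of_le (by positivity) hk1
  have hn0 : (0 : ℝ) < n := by rw [hn]; positivity
  set γ : ι → ℝ := fun i => min (β i) (1 + Real.log (β i / α i)) with hγdef
  induction s using Finset.strongInduction generalizing Γ A with
  | H s ih =>
    have hα0 : ∀ i ∈ s, 0 < α i := fun i hi => lt_of_lt_of_le (by positivity) (hα i hi)
    have hsum : ∀ G ⊆ s, ∑ i ∈ G, ms i ≤ n → ∑ i ∈ G, α i * γ i ≤ k * Γ := by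
      intro G hG hGn
      have h1 : (∑ i ∈ G, α i) * ((n : ℝ) / k) ≤ k * (n / k) := by
        rw [sum_mul, ← sum_congr rfl (fun i _ => hms i), mul_div_cancel₀ _ hk0.ne']
        exact_mod_cast hGn
      have h2 := le_of_mul_le_mul_right h1 (by positivity)
      calc ∑ i ∈ G, α i * γ i ≤ ∑ i ∈ G, α i * Γ := sum_le_sum fun i hi =>
            mul_le_mul_of_nonneg_left (hγ i (hG hi)) (hα0 i (hG hi)).le
        _ = (∑ i ∈ G, α i) * Γ := by rw [sum_mul]
        _ ≤ _ := mul_le_mul_of_nonneg_right h2 hΓ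
    rcases le_or_gt (∑ i ∈ s, ms i) n with hsn | hsn
    · refine ⟨fun _ => ∅, fun _ => ∅, by simp, by simp, ?_⟩
      have h1 := hsum s Subset.rfl hsn
      have h2 : 1 ≤ Real.exp (-((∑ i ∈ s, α i * γ i - k * Γ) / 48)) :=
        Real.one_le_exp (by linarith)
      simpa using le_mul_of_one_le_right (Nat.cast_nonneg #A) h2
    · obtain ⟨G, hGs, hGn, ⟨j, hjs, hj⟩, hGγ⟩ := exists_top_subset s γ ms hsn
      have hge : (n : ℝ) - u * (n / k) ≤ ∑ i ∈ G, (ms i : ℝ) := by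
        have h1 : (n : ℝ) ≤ ∑ i ∈ G, (ms i : ℝ) + ms j := by exact_mod_cast hj.le
        have h2 : (ms j : ℝ) ≤ u * (n / k) := by
          rw [hms]
          have := (hαβ j hjs).trans (hβ j hjs)
          gcongr
        linarith
      have hGne : G.Nonempty := by
        rw [nonempty_iff_ne_empty]
        rintro rfl
        rw [sum_empty] at hge
        have h1 : u < k := by
          refine lt_of_lt_of_le ?_ hk1
          exact lt_self_pow₀ (by linarith) (by norm_num)
        have h2 : u * ((n : ℝ) / k) < k * (n / k) := by gcongr
        rw [mul_div_cancel₀ _ hk0.ne'] at h2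
        linarith
      obtain ⟨i₀, hi₀, hmin⟩ := exists_min_image G γ hGne
      have hi₀s := hGs hi₀
      have hlog : ∀ i ∈ s, 0 ≤ Real.log (β i / α i) := fun i hi => by
        apply Real.log_nonneg
        rw [le_div_iff₀ (hα0 i hi), one_mul]
        exact hαβ i hi
      have hΓ' : 1 / u ≤ γ i₀ := by
        refine le_min ((hα _ hi₀s).trans (hαβ _ hi₀s)) ?_
        have : 1 / u ≤ 1 := by rw [div_le_one hu0]; linarith
        linarith [hlog _ hi₀s]
      obtain ⟨V₁, W₁, hV₁, hW₁, hc₁⟩ := exists_group_card_filter_le_exp hu hn hk1 hk2 S T hS hT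
        ms ns α β G hGne (fun i hi => hα0 i (hGs hi)) (fun i hi => hαβ i (hGs hi))
        (fun i hi => by
          refine (hβ i (hGs hi)).trans ?_
          have := hα i (hGs hi)
          rw [div_le_iff₀ hu0] at this
          nlinarith) hms hns hΓ'
        (fun i hi => (hmin i hi).trans (min_le_left _ _))
        (fun i hi => (hmin i hi).trans (min_le_right _ _)) hGn hge A
      have hss : s \ G ⊂ s := sdiff_ssubset hGs hGne
      obtain ⟨V₂, W₂, hV₂, hW₂, hc₂⟩ := ih (s \ G) hss (fun i hi => hα i (hss.1 hi))
        (fun i hi => hαβ i (hss.1 hi)) (fun i hi => hβ i (hss.1 hi)) (γ i₀)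
        (le_trans (by positivity) hΓ') (fun i hi => hGγ i₀ hi₀ i hi)
        (A.filter fun p => ∀ i ∈ G, Disjoint (V₁ i) (S p) ∨ Disjoint (W₁ i) (T p))
      refine ⟨fun i => if i ∈ G then V₁ i else V₂ i, fun i => if i ∈ G then W₁ i else W₂ i,
        fun i hi => ?_, fun i hi => ?_, ?_⟩
      · by_cases h : i ∈ G
        · simpa [h] using (hV₁ i h).le
        · simpa [h] using hV₂ i (mem_sdiff.2 ⟨hi, h⟩)
      · by_cases h : i ∈ G
        · simpa [h] using hW₁ i
        · simpa [h] using hW₂ i (mem_sdiff.2 ⟨hi, h⟩)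
      · refine le_trans (Nat.cast_le.2 (card_le_card ?_)) (hc₂.trans
          ((mul_le_mul_of_nonneg_right hc₁ (Real.exp_pos _).le).trans ?_))
        · intro p hp
          obtain ⟨hpA, hp⟩ := mem_filter.1 hp
          refine mem_filter.2 ⟨mem_filter.2 ⟨hpA, fun i hi => ?_⟩, fun i hi => ?_⟩
          · simpa [hi] using hp i (hGs hi)
          · simpa [(mem_sdiff.1 hi).2] using hp i (mem_sdiff.1 hi).1
        · rw [mul_assoc, ← Real.exp_add]
          refine mul_le_mul_of_nonneg_left (Real.exp_le_exp.2 ?_) (Nat.cast_nonneg _)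
          have h1 := hsum G hGs hGn
          have h2 := sum_sdiff (f := fun i => α i * γ i) hGs
          linarith

/-- If the total weight is large, some choice of the sets leaves no pair unjoined. -/
lemma exists_forall_exists_not_disjoint {ι : Type*} [DecidableEq ι] {n k : ℕ} {u : ℝ}
    (hu : 100 ≤ u) (hn : (n : ℝ) = u ^ 100) (hk1 : u ^ 10 ≤ k) (hk2 : (k : ℝ) ≤ u ^ 90)
    (ms ns : ι → ℕ) (α β : ι → ℝ)
    (hms : ∀ i, (ms i : ℝ) = α i * ((n : ℝ) / k)) (hns : ∀ i, (ns i : ℝ) = β i * ((n : ℝ) / k))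
    (s : Finset ι) (hα : ∀ i ∈ s, 1 / u ≤ α i) (hαβ : ∀ i ∈ s, α i ≤ β i)
    (hβ : ∀ i ∈ s, β i ≤ u)
    (hw : 100 * k * Real.log n ≤ ∑ i ∈ s, α i * min (β i) (1 + Real.log (β i / α i))) :
    ∃ V W : ι → Finset (Fin n), (∀ i ∈ s, (V i).card ≤ ms i) ∧ (∀ i ∈ s, (W i).card ≤ ns i) ∧
      ∀ S T : Finset (Fin n), S.card = k → T.card = k →
        ∃ i ∈ s, ¬ Disjoint (V i) S ∧ ¬ Disjoint (W i) T := by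
  have hu0 : 0 < u := by linarith
  have hk0 : (0 : ℝ) < k := lt_of_lt_of_le (by positivity) hk1
  have hn0 : (0 : ℝ) < n := by rw [hn]; positivity
  have hlogn : Real.log n = 100 * Real.log u := by rw [hn, Real.log_pow]; norm_num
  have hlogu : 1 ≤ Real.log u := by
    rw [Real.le_log_iff_exp_le hu0]
    linarith [Real.exp_one_lt_d9]
  let Q := {S : Finset (Fin n) // S.card = k}
  obtain ⟨V, W, hV, hW, hc⟩ := exists_card_filter_le_exp (P := Q × Q) hu hn hk1 hk2
    (fun p => p.1.1) (fun p => p.2.1) (fun p => p.1.2) (fun p => p.2.2) ms ns α β hms hns s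
    hα hαβ hβ (Real.log n) (by linarith) (fun i hi => by
      refine (min_le_right _ _).trans ?_
      have hα0 : 0 < α i := lt_of_lt_of_le (by positivity) (hα i hi)
      have h1 : β i / α i ≤ u ^ 2 := by
        rw [div_le_iff₀ hα0]
        have := hα i hi
        rw [div_le_iff₀ hu0] at this
        nlinarith [hβ i hi]
      have h2 := Real.log_le_log (div_pos (hα0.trans_le (hαβ i hi)) hα0) h1
      rw [Real.log_pow] at h2
      push_cast at h2
      linarith) univ
  refine ⟨V, W, hV, hW, fun S T hS hT => ?_⟩
  by_contra! hcon
  have hpos : (1 : ℝ) ≤ #{p ∈ (univ : Finset (Q × Q)) |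
      ∀ i ∈ s, Disjoint (V i) p.1.1 ∨ Disjoint (W i) p.2.1} := by
    rw [Nat.one_le_cast, Nat.one_le_iff_ne_zero, ← Nat.pos_iff_ne_zero, card_pos]
    refine ⟨(⟨S, hS⟩, ⟨T, hT⟩), mem_filter.2 ⟨mem_univ _, fun i hi => ?_⟩⟩
    by_cases h : Disjoint (V i) S
    · exact Or.inl h
    · exact Or.inr (hcon i hi h)
  have hcard : (#(univ : Finset (Q × Q)) : ℝ) ≤ Real.exp (2 * k * Real.log n) := by
    have h1 : #(univ : Finset (Q × Q)) = n.choose k * n.choose k := by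
      rw [card_univ, Fintype.card_prod]
      simp only [Q, Fintype.card_finset_len, Fintype.card_fin]
    have h2 : (n.choose k : ℝ) ≤ (n : ℝ) ^ k := by exact_mod_cast Nat.choose_le_pow n k
    have h3 : Real.exp (2 * k * Real.log n) = (n : ℝ) ^ k * (n : ℝ) ^ k := by
      rw [← Real.exp_log hn0, ← Real.exp_nat_mul, ← Real.exp_add, Real.log_exp]
      ring_nf
    rw [h1, h3]
    push_cast
    gcongr
  have h4 := hpos.trans (hc.trans (mul_le_mul_of_nonneg_right hcard (Real.exp_pos _).le))
  rw [← Real.exp_add, Real.one_le_exp_iff] at h4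
  have : 0 < k * Real.log n := mul_pos hk0 (by linarith)
  linarith

lemma add_mul_binEnt_le {a b : ℝ} (ha : 0 < a) (hab : a ≤ b) :
    (a + b) * binEnt (a / (a + b)) ≤ 2 * (a * (1 + Real.log (b / a))) := by
  have hb : 0 < b := ha.trans_le hab
  have h1 : 1 - a / (a + b) = b / (a + b) := by field_simp; ring
  have h2 : (a + b) * binEnt (a / (a + b)) =
      a * Real.log ((a + b) / a) + b * Real.log ((a + b) / b) := by
    rw [binEnt, h1, ← inv_div (a + b) a, ← inv_div (a + b) b, Real.log_inv, Real.log_inv]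
    field_simp
    ring
  have h3 : Real.log ((a + b) / a) ≤ 1 + Real.log (b / a) := by
    calc Real.log ((a + b) / a) ≤ Real.log (2 * (b / a)) := by
          apply Real.log_le_log (by positivity)
          rw [← mul_div_assoc]
          gcongr
          linarith
      _ = Real.log 2 + Real.log (b / a) := Real.log_mul two_ne_zero (by positivity)
      _ ≤ _ := by linarith [Real.log_two_lt_d9]
  have h4 : b * Real.log ((a + b) / b) ≤ a := by
    have h5 := Real.log_le_sub_one_of_pos (x := (a + b) / b) (by positivity)
    calc b * Real.log ((a + b) / b) ≤ b * ((a + b) / b - 1) := by gcongr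
      _ = a := by field_simp; ring
  have h6 : 0 ≤ Real.log (b / a) := Real.log_nonneg (by rwa [le_div_iff₀ ha, one_mul])
  rw [h2]
  nlinarith

lemma min_mul_binEnt_le {a b : ℝ} (ha : 0 < a) (hab : a ≤ b) :
    min (a * b) ((a + b) * binEnt (a / (a + b))) ≤
      2 * (a * min b (1 + Real.log (b / a))) := by
  rcases le_total b (1 + Real.log (b / a)) with h | h
  · rw [min_eq_left h]
    exact (min_le_left _ _).trans (by nlinarith)
  · rw [min_eq_right h]
    exact (min_le_right _ _).trans (add_mul_binEnt_le ha hab)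

lemma binEnt_div_add_comm {a b : ℝ} (h : a + b ≠ 0) :
    binEnt (a / (a + b)) = binEnt (b / (b + a)) := by
  have h1 : 1 - a / (a + b) = b / (b + a) := by rw [add_comm b a]; field_simp; ring
  have h2 : 1 - b / (b + a) = a / (a + b) := by rw [← h1]; ring
  rw [binEnt, binEnt, h1, h2]
  ring

/-- Smaller sets suffice, since enlarging them only adds edges. -/
lemma isStrongPairs_of_card_le {n k r : ℕ} {ms ns : Fin r → ℕ} (hms : ∀ i, ms i ≤ n)
    (hns : ∀ i, ns i ≤ n) (s : Finset (Fin r)) (V W : Fin r → Finset (Fin n))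
    (hV : ∀ i ∈ s, (V i).card ≤ ms i) (hW : ∀ i ∈ s, (W i).card ≤ ns i)
    (h : ∀ S T : Finset (Fin n), S.card = k → T.card = k →
      ∃ i ∈ s, ¬ Disjoint (V i) S ∧ ¬ Disjoint (W i) T) : IsStrongPairs n k r ms ns := by
  have key : ∀ (V : Fin r → Finset (Fin n)) (ms : Fin r → ℕ), (∀ i, ms i ≤ n) →
      (∀ i ∈ s, (V i).card ≤ ms i) →
      ∀ i, ∃ D : Finset (Fin n), D.card = ms i ∧ (i ∈ s → V i ⊆ D) := by
    intro V ms hms hV i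
    by_cases hi : i ∈ s
    · obtain ⟨D, hD, hDc⟩ := exists_superset_card_eq (hV i hi) (by simpa using hms i)
      exact ⟨D, hDc, fun _ => hD⟩
    · obtain ⟨D, -, hDc⟩ := exists_subset_card_eq (s := (univ : Finset (Fin n))) (n := ms i)
        (by simpa using hms i)
      exact ⟨D, hDc, fun h => absurd h hi⟩
  choose V' hV'c hV' using key V ms hms hV
  choose W' hW'c hW' using key W ns hns hW
  refine ⟨V', W', hV'c, hW'c, ?_⟩
  rintro ⟨S, T, hS, hT, hST⟩
  obtain ⟨i, hi, h1, h2⟩ := h S T hS hT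
  obtain ⟨a, haV, haS⟩ := not_disjoint_iff.1 h1
  obtain ⟨b, hbW, hbT⟩ := not_disjoint_iff.1 h2
  exact hST a haS b hbT (by simpa using ⟨i, hV' i hi haV, hW' i hi hbW⟩)

end

/-- Sufficient condition (asymmetric case): there exists `C > 0` such that for all
sufficiently large `n`, if `n^(1/10) ≤ k ≤ n^(9/10)`,
`α_i, β_i ∈ [n^(-1/100), n^(1/100)]`, `m_i := α_i · (n/k)` and `n_i := β_i · (n/k)`
are positive integers, and for every `X ⊆ {1, …, r}` we have
`∑_{i ∈ X} α_i β_i + ∑_{i ∉ X} (α_i + β_i) H(p_i) ≥ C · k · log n` with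
`p_i = α_i/(α_i + β_i)`, then `((m_1, n_1), …, (m_r, n_r))` is `(n, k)`-strong. -/
theorem stmt_8 :
    ∃ C : ℝ, C > 0 ∧ ∃ N : ℕ, ∀ n : ℕ, N ≤ n →
      ∀ k : ℕ, (n : ℝ) ^ ((1 : ℝ) / 10) ≤ (k : ℝ) → (k : ℝ) ≤ (n : ℝ) ^ ((9 : ℝ) / 10) →
      ∀ r : ℕ, ∀ α β : Fin r → ℝ, ∀ ms ns : Fin r → ℕ,
      (∀ i, (n : ℝ) ^ (-(1 : ℝ) / 100) ≤ α i ∧ α i ≤ (n : ℝ) ^ ((1 : ℝ) / 100)) →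
      (∀ i, (n : ℝ) ^ (-(1 : ℝ) / 100) ≤ β i ∧ β i ≤ (n : ℝ) ^ ((1 : ℝ) / 100)) →
      (∀ i, 0 < ms i) → (∀ i, 0 < ns i) →
      (∀ i, (ms i : ℝ) = α i * ((n : ℝ) / (k : ℝ))) →
      (∀ i, (ns i : ℝ) = β i * ((n : ℝ) / (k : ℝ))) →
      (∀ X : Finset (Fin r),
        (∑ i ∈ X, α i * β i) +
          (∑ i ∈ Xᶜ, (α i + β i) * binEnt (α i / (α i + β i))) ≥
            C * (k : ℝ) * Real.log n) →
      IsStrongPairs n k r ms ns := by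
  refine ⟨400, by norm_num, 100 ^ 100, ?_⟩
  intro n hnN k hk1 hk2 r α β ms ns hα hβ _ _ hms hns hX
  have hnN' : (100 : ℝ) ^ 100 ≤ n := by exact_mod_cast hnN
  have hn0 : (0 : ℝ) < n := lt_of_lt_of_le (by positivity) hnN'
  set u : ℝ := (n : ℝ) ^ ((1 : ℝ) / 100) with hu_def
  have hun : (n : ℝ) = u ^ 100 := by
    rw [hu_def, ← Real.rpow_natCast, ← Real.rpow_mul hn0.le]
    norm_num
  have hu0 : 0 < u := Real.rpow_pos_of_pos hn0 _
  have hu : 100 ≤ u := by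
    rw [hun] at hnN'
    exact (pow_le_pow_iff_left₀ (by norm_num) hu0.le (by norm_num)).1 hnN'
  have hu10 : (n : ℝ) ^ ((1 : ℝ) / 10) = u ^ 10 := by
    rw [hu_def, ← Real.rpow_natCast, ← Real.rpow_mul hn0.le]
    norm_num
  have hu90 : (n : ℝ) ^ ((9 : ℝ) / 10) = u ^ 90 := by
    rw [hu_def, ← Real.rpow_natCast, ← Real.rpow_mul hn0.le]
    norm_num
  have huinv : (n : ℝ) ^ (-(1 : ℝ) / 100) = 1 / u := by
    rw [hu_def, one_div, ← Real.rpow_neg hn0.le]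
    norm_num
  rw [hu10] at hk1
  rw [hu90] at hk2
  rw [huinv] at hα hβ
  have hk0 : (0 : ℝ) < k := lt_of_lt_of_le (by positivity) hk1
  have hα0 : ∀ i, 0 < α i := fun i => lt_of_lt_of_le (by positivity) (hα i).1
  have hβ0 : ∀ i, 0 < β i := fun i => lt_of_lt_of_le (by positivity) (hβ i).1
  have huk : u ≤ k := (le_self_pow₀ (by linarith) (by norm_num)).trans hk1
  have hsize : ∀ (m : ℕ) (a : ℝ), a ≤ u → (m : ℝ) = a * ((n : ℝ) / k) → m ≤ n := by
    intro m a ha hm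
    have : (m : ℝ) ≤ n := by
      calc (m : ℝ) = a * ((n : ℝ) / k) := hm
        _ ≤ k * ((n : ℝ) / k) := by
          have := ha.trans huk
          gcongr
        _ = n := mul_div_cancel₀ _ hk0.ne'
    exact_mod_cast this
  have hmsn : ∀ i, ms i ≤ n := fun i => hsize _ _ (hα i).2 (hms i)
  have hnsn : ∀ i, ns i ≤ n := fun i => hsize _ _ (hβ i).2 (hns i)
  set w : Fin r → ℝ := fun i => min (α i * β i) ((α i + β i) * binEnt (α i / (α i + β i))) with hw
  have hwsum : 400 * (k : ℝ) * Real.log n ≤ ∑ i, w i := by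
    refine (hX (Finset.univ.filter fun i =>
      α i * β i ≤ (α i + β i) * binEnt (α i / (α i + β i)))).le.trans (le_of_eq ?_)
    rw [← Finset.sum_add_sum_compl (Finset.univ.filter fun i =>
      α i * β i ≤ (α i + β i) * binEnt (α i / (α i + β i))) w]
    congr 1 <;> refine Finset.sum_congr rfl fun i hi => ?_
    · simp only [Finset.mem_filter, Finset.mem_univ, true_and] at hi
      exact (min_eq_left hi).symm
    · simp only [Finset.mem_compl, Finset.mem_filter, Finset.mem_univ, true_and, not_le] at hi
      exact (min_eq_right hi.le).symm
  rw [← Finset.sum_filter_add_sum_filter_not Finset.univ (fun i => α i ≤ β i)] at hwsum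
  rcases le_total (200 * (k : ℝ) * Real.log n) (∑ i with α i ≤ β i, w i) with h | h
  · obtain ⟨V, W, hV, hW, hVW⟩ := exists_forall_exists_not_disjoint hu hun hk1 hk2 ms ns α β
      hms hns (Finset.univ.filter fun i => α i ≤ β i) (fun i _ => (hα i).1)
      (fun i hi => (Finset.mem_filter.1 hi).2) (fun i _ => (hβ i).2) (by
        have h1 := Finset.sum_le_sum fun i (hi : i ∈ Finset.univ.filter fun i => α i ≤ β i) =>
          min_mul_binEnt_le (hα0 i) (Finset.mem_filter.1 hi).2
        rw [← Finset.mul_sum] at h1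
        linarith)
    exact isStrongPairs_of_card_le hmsn hnsn _ V W hV hW hVW
  · obtain ⟨W, V, hW, hV, hVW⟩ := exists_forall_exists_not_disjoint hu hun hk1 hk2 ns ms β α
      hns hms (Finset.univ.filter fun i => ¬ α i ≤ β i) (fun i _ => (hβ i).1)
      (fun i hi => (not_le.1 (Finset.mem_filter.1 hi).2).le) (fun i _ => (hα i).2) (by
        have h1 := Finset.sum_le_sum fun i (hi : i ∈ Finset.univ.filter fun i => ¬ α i ≤ β i) =>
          min_mul_binEnt_le (hβ0 i) (not_le.1 (Finset.mem_filter.1 hi).2).le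
        rw [← Finset.mul_sum] at h1
        have h2 : ∀ i, min (β i * α i) ((β i + α i) * binEnt (β i / (β i + α i))) = w i :=
          fun i => by
            rw [hw, binEnt_div_add_comm (add_pos (hβ0 i) (hα0 i)).ne', mul_comm (β i),
              add_comm (β i)]
        simp_rw [h2] at h1
        linarith)
    refine isStrongPairs_of_card_le hmsn hnsn _ V W hV hW fun S T hS hT => ?_
    obtain ⟨i, hi, h1, h2⟩ := hVW T S hT hS
    exact ⟨i, hi, h2, h1⟩
end
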